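/- Let V be a real polynomial in d variables. Then there exists C > 0 such that for all complex-valued u ∈ C_0^∞(ℝ^d), Σ_{j,ℓ=1}^d ‖ ∂²u/∂x_j∂x_ℓ ‖ + ‖ V u ‖ ≤ C ‖ (−Δ + iV) u ‖, where all norms are L²(ℝ^d) norms. -/

import Mathlib

open MeasureTheory Real Filter

noncomputable section

/-- `ℝ^d` with the Euclidean structure. -/
abbrev Rd (d : ℕ) := EuclideanSpace ℝ (Fin d)

/-- Partial derivative `∂_{x_j}` of a complex-valued function. -/
def pdC {d : ℕ} (j : Fin d) (f : Rd d → ℂ) : Rd d → ℂ :=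
  fun x => fderiv ℝ f x (EuclideanSpace.single j (1:ℝ))

/-- Partial derivative `∂_{x_j}` of a real-valued function. -/
def pdR {d : ℕ} (j : Fin d) (f : Rd d → ℝ) : Rd d → ℝ :=
  fun x => fderiv ℝ f x (EuclideanSpace.single j (1:ℝ))

/-- Iterated partial derivative in the `j`-th direction. -/
def pdIter {d : ℕ} (j : Fin d) : ℕ → (Rd d → ℝ) → (Rd d → ℝ)
  | 0, f => f
  | n+1, f => pdR j (pdIter j n f)

/-- Multi-index partial derivative `∂^α`. -/
def pdMulti {d : ℕ} (α : Fin d → ℕ) (f : Rd d → ℝ) : Rd d → ℝ :=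
  (List.finRange d).foldr (fun j g => pdIter j (α j) g) f

/-- The finite set of multi-indices `α` with `|α| = q`. -/
def mIdx (d q : ℕ) : Finset (Fin d → ℕ) := Finset.Nat.antidiagonalTuple d q

/-- The magnetic field `B_{jk} = ∂_j A_k - ∂_k A_j`. -/
def magB {d : ℕ} (A : Fin d → Rd d → ℝ) (j k : Fin d) : Rd d → ℝ :=
  fun x => pdR j (A k) x - pdR k (A j) x

/-- The quantity `m̌_q(x)`. -/
def mq {d p : ℕ} (A : Fin d → Rd d → ℝ) (U : Fin p → Rd d → ℝ) (V : Rd d → ℝ) :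
    ℕ → Rd d → ℝ
  | 0, x => ∑ ℓ, |U ℓ x|
  | q+1, x =>
      (∑ ℓ, ∑ α ∈ mIdx d (q+1), |pdMulti α (U ℓ) x|)
      + (∑ jk ∈ Finset.univ.filter (fun jk : Fin d × Fin d => jk.1 < jk.2),
          ∑ α ∈ mIdx d q, |pdMulti α (magB A jk.1 jk.2) x|)
      + ∑ α ∈ mIdx d q, |pdMulti α V x|

/-- The quantity `m̌ʳ(x) = 1 + ∑_{q=0}^r m̌_q(x)`. -/
def mr {d p : ℕ} (A : Fin d → Rd d → ℝ) (U : Fin p → Rd d → ℝ) (V : Rd d → ℝ)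
    (r : ℕ) (x : Rd d) : ℝ :=
  1 + ∑ q ∈ Finset.range (r+1), mq A U V q x

/-- The magnetic derivative `X_j u = (D_{x_j} - A_j) u`, `D_{x_j} = -i ∂_{x_j}`. -/
def Xop {d : ℕ} (A : Fin d → Rd d → ℝ) (j : Fin d) (u : Rd d → ℂ) : Rd d → ℂ :=
  fun x => -Complex.I * pdC j u x - (A j x : ℂ) * u x

/-- The potential `W = ∑_ℓ U_ℓ² + iV`. -/
def Wfun {d p : ℕ} (U : Fin p → Rd d → ℝ) (V : Rd d → ℝ) (x : Rd d) : ℂ :=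
  ((∑ ℓ, (U ℓ x)^2 : ℝ) : ℂ) + (V x : ℝ) * Complex.I

/-- The operator `P_{A,W} u = ∑_j X_j² u + W u` with `W = ∑_ℓ U_ℓ² + iV`. -/
def Pop {d p : ℕ} (A : Fin d → Rd d → ℝ) (U : Fin p → Rd d → ℝ) (V : Rd d → ℝ)
    (u : Rd d → ℂ) : Rd d → ℂ :=
  fun x => (∑ j, Xop A j (Xop A j u) x) + Wfun U V x * u x

/-- The function `Φ(x,t)`. -/
def Phi {d p : ℕ} (A : Fin d → Rd d → ℝ) (U : Fin p → Rd d → ℝ) (V : Rd d → ℝ)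
    (r : ℕ) (x : Rd d) (t : ℝ) : ℝ :=
  (∑ ℓ, ∑ q ∈ Finset.range (r+1), t^(q+1) * ∑ α ∈ mIdx d q, |pdMulti α (U ℓ) x|)
  + (∑ jk ∈ Finset.univ.filter (fun jk : Fin d × Fin d => jk.1 < jk.2),
      ∑ q ∈ Finset.range r, t^(q+2) * ∑ α ∈ mIdx d q, |pdMulti α (magB A jk.1 jk.2) x|)
  + ∑ q ∈ Finset.range r, t^(q+2) * ∑ α ∈ mIdx d q, |pdMulti α V x|

/-- `R(x,μ) = sup { t ∈ [0,1] : Φ(x,t) ≤ μ }`. -/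
def Rfun {d p : ℕ} (A : Fin d → Rd d → ℝ) (U : Fin p → Rd d → ℝ) (V : Rd d → ℝ)
    (r : ℕ) (x : Rd d) (μ : ℝ) : ℝ :=
  sSup {t : ℝ | t ∈ Set.Icc (0:ℝ) 1 ∧ Phi A U V r x t ≤ μ}


section Toolkit

variable {d : ℕ}

lemma pdR_mul {f g : Rd d → ℝ} (hf : Differentiable ℝ f) (hg : Differentiable ℝ g) (j : Fin d)
    (x : Rd d) :
    pdR j (fun y => f y * g y) x = pdR j f x * g x + f x * pdR j g x := by
  unfold pdR
  rw [fderiv_fun_mul (hf x) (hg x)]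
  simp
  ring

lemma pdR_add {f g : Rd d → ℝ} (hf : Differentiable ℝ f) (hg : Differentiable ℝ g) (j : Fin d)
    (x : Rd d) :
    pdR j (fun y => f y + g y) x = pdR j f x + pdR j g x := by
  unfold pdR
  rw [fderiv_fun_add (hf x) (hg x)]
  simp

lemma pdR_sub {f g : Rd d → ℝ} (hf : Differentiable ℝ f) (hg : Differentiable ℝ g) (j : Fin d)
    (x : Rd d) :
    pdR j (fun y => f y - g y) x = pdR j f x - pdR j g x := by
  unfold pdR
  rw [fderiv_fun_sub (hf x) (hg x)]
  simp

lemma pdR_pow {f : Rd d → ℝ} (hf : Differentiable ℝ f) (n : ℕ) (j : Fin d)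
    (x : Rd d) :
    pdR j (fun y => f y ^ n) x = n * f x ^ (n - 1) * pdR j f x := by
  unfold pdR
  rw [fderiv_fun_pow n (hf x)]
  simp

lemma pdR_sum {ι : Type*} (s : Finset ι) {f : ι → Rd d → ℝ} (hf : ∀ i ∈ s, Differentiable ℝ (f i))
    (j : Fin d) (x : Rd d) :
    pdR j (fun y => ∑ i ∈ s, f i y) x = ∑ i ∈ s, pdR j (f i) x := by
  unfold pdR
  rw [fderiv_fun_sum (fun i hi => hf i hi x)]
  simp

lemma pdR_const (c : ℝ) (j : Fin d) (x : Rd d) : pdR j (fun _ => c) x = 0 := by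
  unfold pdR; simp

lemma pdR_const_mul {f : Rd d → ℝ} (c : ℝ) (hf : Differentiable ℝ f) (j : Fin d) (x : Rd d) :
    pdR j (fun y => c * f y) x = c * pdR j f x := by
  rw [pdR_mul (differentiable_const c) hf, pdR_const]; ring

lemma ContDiff.pdR' {f : Rd d → ℝ} (hf : ContDiff ℝ (⊤ : ℕ∞) f) (j : Fin d) :
    ContDiff ℝ (⊤ : ℕ∞) (pdR j f) := by
  unfold pdR
  exact (hf.fderiv_right (m := (⊤ : ℕ∞)) (by simp)).clm_apply contDiff_const

lemma ContDiff.dif' {f : Rd d → ℝ} (hf : ContDiff ℝ (⊤ : ℕ∞) f) : Differentiable ℝ f :=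
  hf.differentiable (by simp)

lemma pdR_vanish {f : Rd d → ℝ} {K : Set (Rd d)} (hK : IsClosed K) (h : ∀ x ∉ K, f x = 0)
    (j : Fin d) : ∀ x ∉ K, pdR j f x = 0 := by
  intro x hx
  have : f =ᶠ[nhds x] fun _ => 0 := by
    filter_upwards [hK.isOpen_compl.mem_nhds hx] with y hy using h y hy
  unfold pdR
  rw [this.fderiv_eq]; simp

lemma pdR_comm {f : Rd d → ℝ} (hf : ContDiff ℝ (⊤ : ℕ∞) f) (i j : Fin d) :
    pdR i (pdR j f) = pdR j (pdR i f) := by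
  funext x
  have hs : IsSymmSndFDerivAt ℝ f x :=
    hf.contDiffAt.isSymmSndFDerivAt (by
      simp only [minSmoothness_of_isRCLikeNormedField]; exact WithTop.coe_le_coe.2 (le_top : (2:ℕ∞) ≤ ⊤))
  have h2 : Differentiable ℝ (fderiv ℝ f) :=
    (hf.fderiv_right (m := (⊤ : ℕ∞)) (by simp)).differentiable (by simp)
  unfold pdR
  rw [fderiv_clm_apply (h2 x) (by fun_prop), fderiv_clm_apply (h2 x) (by fun_prop)]
  simp
  exact hs _ _

lemma integrable_cs {f : Rd d → ℝ} {K : Set (Rd d)} (hK : IsCompact K) (hf : Continuous f)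
    (h : ∀ x ∉ K, f x = 0) : Integrable f :=
  hf.integrable_of_hasCompactSupport (HasCompactSupport.intro hK h)

lemma integral_pdR {f : Rd d → ℝ} {K : Set (Rd d)} (hK : IsCompact K)
    (hf : ContDiff ℝ (⊤ : ℕ∞) f) (h : ∀ x ∉ K, f x = 0) (j : Fin d) :
    ∫ x, pdR j f x = 0 := by
  have h1 := integral_mul_fderiv_eq_neg_fderiv_mul_of_integrable (μ := (volume : Measure (Rd d)))
    (f := fun _ => (1:ℝ)) (g := f) (v := EuclideanSpace.single j (1:ℝ)) (by simp)
    (by simp only [one_mul]; exact integrable_cs hK (hf.pdR' j).continuous (pdR_vanish hK.isClosed h j))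
    (by simpa using integrable_cs hK hf.continuous h) (fun x _ => by fun_prop)
    (fun x _ => hf.dif' x)
  simpa [pdR] using h1

/-- Integration of a pointwise inequality modulo a divergence. -/
lemma int_le_of_div {G H : Rd d → ℝ} {F : Fin d → Rd d → ℝ} {K : Set (Rd d)} (hK : IsCompact K)
    (hF : ∀ j, ContDiff ℝ (⊤ : ℕ∞) (F j)) (hF0 : ∀ j, ∀ x ∉ K, F j x = 0)
    (hG : Integrable G) (hH : Integrable H) (h : ∀ x, G x ≤ H x + ∑ j, pdR j (F j) x) :
    ∫ x, G x ≤ ∫ x, H x := by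
  have hi : ∀ j, Integrable (pdR j (F j)) := fun j =>
    integrable_cs hK ((hF j).pdR' j).continuous (pdR_vanish hK.isClosed (hF0 j) j)
  have hs : Integrable (fun x => ∑ j, pdR j (F j) x) := integrable_finsetSum _ (fun j _ => hi j)
  calc ∫ x, G x ≤ ∫ x, (H x + ∑ j, pdR j (F j) x) := integral_mono hG (hH.add hs) h
    _ = ∫ x, H x := by
      rw [integral_add hH hs, integral_finsetSum _ (fun j _ => hi j)]
      simp [integral_pdR hK (hF _) (hF0 _)]

end Toolkit

section Analytic

variable {d : ℕ}

lemma int_le_four {G H₁ H₂ H₃ H₄ : Rd d → ℝ} {F : Fin d → Rd d → ℝ} {K : Set (Rd d)}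
    (hK : IsCompact K) (c₁ c₂ c₃ c₄ : ℝ)
    (hF : ∀ j, ContDiff ℝ (⊤ : ℕ∞) (F j)) (hF0 : ∀ j, ∀ x ∉ K, F j x = 0)
    (hG : Integrable G) (h₁ : Integrable H₁) (h₂ : Integrable H₂) (h₃ : Integrable H₃)
    (h₄ : Integrable H₄)
    (h : ∀ x, G x ≤ (c₁ * H₁ x + c₂ * H₂ x + c₃ * H₃ x + c₄ * H₄ x) + ∑ j, pdR j (F j) x) :
    ∫ x, G x ≤ c₁ * (∫ x, H₁ x) + c₂ * (∫ x, H₂ x) + c₃ * (∫ x, H₃ x) + c₄ * (∫ x, H₄ x) := by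
  have i₁ := h₁.const_mul c₁
  have i₂ := h₂.const_mul c₂
  have i₃ := h₃.const_mul c₃
  have i₄ := h₄.const_mul c₄
  have := int_le_of_div hK hF hF0 hG (((i₁.add i₂).add i₃).add i₄) h
  refine this.trans (le_of_eq ?_)
  rw [integral_add' ((i₁.add i₂).add i₃) i₄, integral_add' (i₁.add i₂) i₃, integral_add' i₁ i₂]
  simp only [integral_const_mul]

/-- Laplacian of a real function. -/
def lapR (a : Rd d → ℝ) (x : Rd d) : ℝ := ∑ j, pdR j (pdR j a) x

def eD (a b : Rd d → ℝ) (x : Rd d) : ℝ := a x ^ 2 + b x ^ 2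

def gD (a b : Rd d → ℝ) (x : Rd d) : ℝ := ∑ j, (pdR j a x ^ 2 + pdR j b x ^ 2)

def fD (V a b : Rd d → ℝ) (x : Rd d) : ℝ :=
  (-lapR a x - V x * b x) ^ 2 + (-lapR b x + V x * a x) ^ 2

/-- Pair of test functions (real and imaginary part). -/
structure TestPair (a b : Rd d → ℝ) (K : Set (Rd d)) : Prop where
  cK : IsCompact K
  sa : ContDiff ℝ (⊤ : ℕ∞) a
  sb : ContDiff ℝ (⊤ : ℕ∞) b
  va : ∀ x ∉ K, a x = 0
  vb : ∀ x ∉ K, b x = 0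

namespace TestPair
variable {a b : Rd d → ℝ} {K : Set (Rd d)}

lemma vpa (h : TestPair a b K) (j : Fin d) : ∀ x ∉ K, pdR j a x = 0 := pdR_vanish h.cK.isClosed h.va j
lemma vpb (h : TestPair a b K) (j : Fin d) : ∀ x ∉ K, pdR j b x = 0 := pdR_vanish h.cK.isClosed h.vb j
lemma vla (h : TestPair a b K) : ∀ x ∉ K, lapR a x = 0 := fun x hx =>
  Finset.sum_eq_zero (fun j _ => pdR_vanish h.cK.isClosed (h.vpa j) j x hx)
lemma vlb (h : TestPair a b K) : ∀ x ∉ K, lapR b x = 0 := fun x hx =>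
  Finset.sum_eq_zero (fun j _ => pdR_vanish h.cK.isClosed (h.vpb j) j x hx)
lemma ve (h : TestPair a b K) : ∀ x ∉ K, eD a b x = 0 := fun x hx => by simp [eD, h.va x hx, h.vb x hx]
lemma vg (h : TestPair a b K) : ∀ x ∉ K, gD a b x = 0 := fun x hx => by simp [gD, h.vpa _ x hx, h.vpb _ x hx]
lemma cla (h : TestPair a b K) : Continuous (lapR a) :=
  continuous_finsetSum _ (fun j _ => ((h.sa.pdR' j).pdR' j).continuous)
lemma clb (h : TestPair a b K) : Continuous (lapR b) :=
  continuous_finsetSum _ (fun j _ => ((h.sb.pdR' j).pdR' j).continuous)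
lemma ce (h : TestPair a b K) : Continuous (eD a b) := by
  have := h.sa.continuous; have := h.sb.continuous
  unfold eD; fun_prop
lemma cg (h : TestPair a b K) : Continuous (gD a b) := by
  have := fun j => (h.sa.pdR' j).continuous
  have := fun j => (h.sb.pdR' j).continuous
  unfold gD; fun_prop

lemma ie (h : TestPair a b K) {c : Rd d → ℝ} (hc : Continuous c) : Integrable (fun x => c x * eD a b x) := by
  have := h.ce
  exact integrable_cs h.cK (by fun_prop) (fun x hx => by simp [h.ve x hx])
lemma ig (h : TestPair a b K) {c : Rd d → ℝ} (hc : Continuous c) : Integrable (fun x => c x * gD a b x) := by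
  have := h.cg
  exact integrable_cs h.cK (by fun_prop) (fun x hx => by simp [h.vg x hx])
lemma jf (h : TestPair a b K) {V : Rd d → ℝ} (hV : Continuous V) : Integrable (fun x => fD V a b x) := by
  have := h.cla
  have := h.clb
  have := h.sa.continuous; have := h.sb.continuous
  exact integrable_cs h.cK (by unfold fD; fun_prop) (fun x hx => by
    simp [fD, h.vla x hx, h.vlb x hx, h.va x hx, h.vb x hx])

end TestPair

lemma young_pt {C m φ c a b p q δ : ℝ} (hc : |c| ≤ C * m * φ) (hφ : 0 ≤ φ) (hC : 0 ≤ C)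
    (hm : 0 ≤ m) (hδ : 0 < δ) :
    |c * (a * p + b * q)| ≤ C * (δ * (m ^ 2 * φ * (a ^ 2 + b ^ 2)) + δ⁻¹ * (φ * (p ^ 2 + q ^ 2))) := by
  rw [abs_mul]
  have h1 : m * |a * p + b * q| ≤ δ * (m ^ 2 * (a ^ 2 + b ^ 2)) + δ⁻¹ * (p ^ 2 + q ^ 2) := by
    have e : δ⁻¹ * δ = 1 := inv_mul_cancel₀ hδ.ne'
    have hi : 0 < δ⁻¹ := inv_pos.2 hδ
    rw [← abs_of_nonneg hm, ← abs_mul, abs_of_nonneg hm]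
    have k : ∀ σ : ℝ, σ ^ 2 = 1 → σ * (m * (a * p + b * q)) ≤
        δ * (m ^ 2 * (a ^ 2 + b ^ 2)) + δ⁻¹ * (p ^ 2 + q ^ 2) := by
      intro σ hσ
      have e1 : 0 ≤ δ⁻¹ * ((δ * m * a - σ * p / 2) ^ 2 + (δ * m * b - σ * q / 2) ^ 2) := by
        positivity
      have e2 : δ⁻¹ * ((δ * m * a - σ * p / 2) ^ 2 + (δ * m * b - σ * q / 2) ^ 2)
        = (δ⁻¹ * δ) * δ * (m ^ 2 * (a ^ 2 + b ^ 2)) - (δ⁻¹ * δ) * σ * (m * (a * p + b * q))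
          + σ ^ 2 * (δ⁻¹ * (p ^ 2 + q ^ 2)) / 4 := by ring
      rw [e2, e, hσ] at e1
      have : 0 ≤ δ⁻¹ * (p ^ 2 + q ^ 2) := by positivity
      nlinarith
    rcases abs_cases (m * (a * p + b * q)) with h | h
    · rw [h.1]; simpa using k 1 (by norm_num)
    · rw [h.1]; simpa using k (-1) (by norm_num)
  calc |c| * |a * p + b * q| ≤ C * m * φ * |a * p + b * q| := by gcongr
    _ = C * φ * (m * |a * p + b * q|) := by ring
    _ ≤ C * φ * (δ * (m ^ 2 * (a ^ 2 + b ^ 2)) + δ⁻¹ * (p ^ 2 + q ^ 2)) := by gcongr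
    _ = _ := by ring

/-- Energy identity with a slowly varying weight. -/
lemma energy_re {a b V m φ : Rd d → ℝ} {K : Set (Rd d)} (h : TestPair a b K)
    (hV : Continuous V) (hm : Continuous m) (hm0 : ∀ x, 0 ≤ m x)
    (sφ : ContDiff ℝ (⊤ : ℕ∞) φ) (hφ : ∀ x, 0 ≤ φ x) {ε : ℝ} (hε : 0 ≤ ε)
    (dφ : ∀ j x, |pdR j φ x| ≤ ε * m x * φ x) {s : ℝ} (hs : 0 < s) :
    ∫ x, φ x * gD a b x ≤ s * (∫ x, fD V a b x) + s⁻¹ * (∫ x, φ x ^ 2 * eD a b x)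
      + (ε * d) * (∫ x, m x ^ 2 * φ x * eD a b x) + ε * (∫ x, φ x * gD a b x) := by
  have cφ := sφ.continuous
  have hpa := fun j => h.sa.pdR' j
  have hpb := fun j => h.sb.pdR' j
  have sa := h.sa
  have sb := h.sb
  refine int_le_four (F := fun j x => φ x * (a x * pdR j a x + b x * pdR j b x)) h.cK s s⁻¹ (ε * d)
    ε ?_ ?_ (h.ig cφ) (h.jf hV) (h.ie (by fun_prop)) (h.ie (by fun_prop)) (h.ig cφ) ?_
  · intro j
    have := hpa j
    have := hpb j
    fun_prop
  · intro j x hx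
    simp [h.va x hx, h.vb x hx]
  intro x
  have hdiv : ∀ j, pdR j (fun x => φ x * (a x * pdR j a x + b x * pdR j b x)) x
      = pdR j φ x * (a x * pdR j a x + b x * pdR j b x)
        + φ x * (pdR j a x ^ 2 + pdR j b x ^ 2)
        + φ x * (a x * pdR j (pdR j a) x + b x * pdR j (pdR j b) x) := by
    intro j
    have d1 := sφ.dif'
    have d2 := sa.dif'
    have d3 := sb.dif'
    have d4 := (hpa j).dif'
    have d5 := (hpb j).dif'
    rw [pdR_mul d1 (by fun_prop), pdR_add (by fun_prop) (by fun_prop), pdR_mul d2 d4,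
      pdR_mul d3 d5]
    ring
  have hy : ∀ j, -(ε * (m x ^ 2 * φ x * eD a b x) + ε * (φ x * (pdR j a x ^ 2 + pdR j b x ^ 2)))
      ≤ pdR j φ x * (a x * pdR j a x + b x * pdR j b x) := by
    intro j
    have := young_pt (a := a x) (b := b x) (p := pdR j a x) (q := pdR j b x) (dφ j x) (hφ x) hε
      (hm0 x) one_pos
    have := neg_le_of_abs_le this
    unfold eD
    simp only [one_mul, inv_one] at this
    linarith
  have hsum : ∑ j, pdR j (fun x => φ x * (a x * pdR j a x + b x * pdR j b x)) x
      ≥ -(ε * d * (m x ^ 2 * φ x * eD a b x) + ε * (φ x * gD a b x)) + φ x * gD a b x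
        + φ x * (a x * lapR a x + b x * lapR b x) := by
    simp only [hdiv, Finset.sum_add_distrib, lapR, gD, Finset.mul_sum]
    have := Finset.sum_le_sum (fun j (_ : j ∈ Finset.univ) => hy j)
    simp only [Finset.sum_neg_distrib, Finset.sum_add_distrib, Finset.sum_const, Finset.card_univ,
      Fintype.card_fin, nsmul_eq_mul, mul_add, Finset.mul_sum] at this ⊢
    linarith
  have hlast : 0 ≤ s * fD V a b x + s⁻¹ * (φ x ^ 2 * eD a b x)
      + φ x * (a x * lapR a x + b x * lapR b x) := by
    have e : s⁻¹ * s = 1 := inv_mul_cancel₀ hs.ne'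
    have hi : 0 < s⁻¹ := inv_pos.2 hs
    have y := young_pt (C := 1) (m := 1) (a := φ x * a x) (b := φ x * b x)
      (p := -lapR a x - V x * b x) (q := -lapR b x + V x * a x) (c := 1) (φ := 1) (δ := s⁻¹)
      (by norm_num) zero_le_one zero_le_one zero_le_one hi
    have y2 := le_of_abs_le y
    rw [inv_inv] at y2
    unfold fD eD
    nlinarith
  linarith [hsum, hlast]

end Analytic

section Analytic2

variable {d : ℕ}

/-- The family of derivatives of the potential, with the gauge function `m` and `n = 1/m`. -/
structure Gauge (g : List (Fin d) → Rd d → ℝ) (m n : Rd d → ℝ) (N₀ : ℝ) : Prop where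
  gs : ∀ l, ContDiff ℝ (⊤ : ℕ∞) (g l)
  gd : ∀ j l x, pdR j (g l) x = g (j :: l) x
  ms : ContDiff ℝ (⊤ : ℕ∞) m
  ns : ContDiff ℝ (⊤ : ℕ∞) n
  mp : ∀ x, 0 < m x
  np : ∀ x, 0 < n x
  mn : ∀ x, m x * n x = 1
  gb : ∀ l x, |g l x| ≤ m x ^ (l.length + 2)
  nd : ∀ j x, |pdR j n x| ≤ N₀
  n0 : 0 ≤ N₀

lemma mn_red {m n : ℝ} (h : m * n = 1) (i k : ℕ) : m ^ (i + k) * n ^ k = m ^ i := by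
  rw [pow_add, mul_assoc, ← mul_pow, h, one_pow, mul_one]

lemma mn_red' {m n : ℝ} (h : m * n = 1) (i k : ℕ) : m ^ k * n ^ (i + k) = n ^ i := by
  rw [pow_add, mul_left_comm, ← mul_pow, h, one_pow, mul_one]

lemma eta_bound {m n φ : Rd d → ℝ} {g : List (Fin d) → Rd d → ℝ} {N₀ : ℝ}
    (G : Gauge g m n N₀) (sφ : ContDiff ℝ (⊤ : ℕ∞) φ) (hφ : ∀ x, 0 ≤ φ x)
    (dφ : ∀ j x, |pdR j φ x| ≤ m x * φ x) (l : List (Fin d)) (q : ℕ) (j : Fin d) (x : Rd d) :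
    |pdR j (fun x => g l x * n x ^ (q + 1) * φ x) x|
      ≤ (2 + (q + 1) * N₀) * (m x ^ (l.length + 3) * n x ^ (q + 1)) * φ x := by
  have d1 := (G.gs l).dif'
  have d2 := G.ns.dif'
  have d3 := sφ.dif'
  have hn := abs_of_pos (G.np x)
  have hp := abs_of_nonneg (hφ x)
  have h1 := hφ x
  have h2 := G.np x
  have h3 := G.mp x
  have h4 := G.nd j x
  have h5 := dφ j x
  have n0 := G.n0
  have e0 := G.gb l x
  have e : pdR j (fun x => g l x * n x ^ (q + 1) * φ x) x = g (j :: l) x * n x ^ (q + 1) * φ x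
      + g l x * (((q : ℝ) + 1) * n x ^ q * pdR j n x) * φ x
      + g l x * n x ^ (q + 1) * pdR j φ x := by
    rw [pdR_mul (by fun_prop) d3, pdR_mul d1 (by fun_prop), pdR_pow d2, G.gd]
    push_cast
    ring
  have e1 : |g (j :: l) x * n x ^ (q + 1) * φ x| ≤ m x ^ (l.length + 3) * n x ^ (q + 1) * φ x := by
    have := G.gb (j :: l) x
    simp only [List.length_cons] at this
    simp only [abs_mul, abs_pow, hn, hp]
    gcongr
  have hq : |(q : ℝ) + 1| = q + 1 := abs_of_nonneg (by positivity)
  have e2 : |g l x * (((q : ℝ) + 1) * n x ^ q * pdR j n x) * φ x|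
      ≤ ((q + 1) * N₀) * (m x ^ (l.length + 3) * n x ^ (q + 1)) * φ x := by
    simp only [abs_mul, abs_pow, hn, hp, hq]
    calc |g l x| * ((q + 1) * n x ^ q * |pdR j n x|) * φ x
        ≤ m x ^ (l.length + 2) * ((q + 1) * n x ^ q * N₀) * φ x := by gcongr
      _ = ((q + 1) * N₀) * (m x ^ (l.length + 2) * n x ^ q) * (m x * n x) * φ x := by
        rw [G.mn x]; ring
      _ = _ := by ring
  have e3 : |g l x * n x ^ (q + 1) * pdR j φ x| ≤ m x ^ (l.length + 3) * n x ^ (q + 1) * φ x := by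
    simp only [abs_mul, abs_pow, hn]
    calc |g l x| * n x ^ (q + 1) * |pdR j φ x|
        ≤ m x ^ (l.length + 2) * n x ^ (q + 1) * (m x * φ x) := by gcongr
      _ = _ := by ring
  rw [e]
  refine (abs_add_le _ _).trans ?_
  have := abs_add_le (g (j :: l) x * n x ^ (q + 1) * φ x)
    (g l x * (((q : ℝ) + 1) * n x ^ q * pdR j n x) * φ x)
  linarith

lemma energy_im {a b m n φ : Rd d → ℝ} {g : List (Fin d) → Rd d → ℝ} {N₀ : ℝ}
    {K : Set (Rd d)} (h : TestPair a b K) (G : Gauge g m n N₀)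
    (sφ : ContDiff ℝ (⊤ : ℕ∞) φ) (hφ : ∀ x, 0 ≤ φ x)
    (dφ : ∀ j x, |pdR j φ x| ≤ m x * φ x) {s δ : ℝ} (hs : 0 < s) (hδ : 0 < δ) :
    ∫ x, (g [] x ^ 2 * n x ^ 2 * φ x) * eD a b x ≤
      s * (∫ x, fD (g []) a b x) + s⁻¹ * (∫ x, φ x ^ 2 * eD a b x)
      + ((2 + 2 * N₀) * d * δ) * (∫ x, m x ^ 2 * φ x * eD a b x)
      + ((2 + 2 * N₀) * δ⁻¹) * (∫ x, φ x * gD a b x) := by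
  have cφ := sφ.continuous
  have cm := G.ms.continuous
  have cn := G.ns.continuous
  have sn := G.ns
  have sg := G.gs
  have cg := fun l => (G.gs l).continuous
  have hpa := fun j => h.sa.pdR' j
  have hpb := fun j => h.sb.pdR' j
  have sa := h.sa
  have sb := h.sb
  have n0 := G.n0
  set ψ : Rd d → ℝ := fun x => g [] x * n x ^ 2 * φ x with hψ
  have sψ : ContDiff ℝ (⊤ : ℕ∞) ψ := by
    have := sg []
    fun_prop
  have dψ : ∀ j x, |pdR j ψ x| ≤ (2 + 2 * N₀) * m x * φ x := by
    intro j x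
    have := eta_bound G sφ hφ dφ [] 1 j x
    simp only [List.length_nil, zero_add] at this
    rw [show (3:ℕ) = 1 + 2 from rfl, show (1 + 1 : ℕ) = 2 from rfl, mn_red (G.mn x)] at this
    refine this.trans (le_of_eq ?_)
    push_cast
    ring_nf
  have bψ : ∀ x, |ψ x| ≤ φ x := by
    intro x
    have e0 := G.gb [] x
    have hn := abs_of_pos (G.np x)
    have hp := abs_of_nonneg (hφ x)
    have h1 := hφ x
    have h2 := G.np x
    simp only [List.length_nil] at e0
    simp only [hψ, abs_mul, abs_pow, hn, hp]
    calc |g [] x| * n x ^ 2 * φ x ≤ m x ^ (0 + 2) * n x ^ 2 * φ x := by gcongr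
      _ = _ := by rw [mn_red (G.mn x)]; simp
  refine int_le_four (F := fun j x => ψ x * (a x * pdR j b x - b x * pdR j a x)) h.cK s s⁻¹ _
    _ ?_ ?_ (h.ie (by have := cg []; fun_prop)) (h.jf (cg [])) (h.ie (by fun_prop))
    (h.ie (by fun_prop)) (h.ig cφ) ?_
  · intro j
    have := hpa j
    have := hpb j
    fun_prop
  · intro j x hx
    simp [h.va x hx, h.vb x hx]
  intro x
  have hdiv : ∀ j, pdR j (fun x => ψ x * (a x * pdR j b x - b x * pdR j a x)) x
      = pdR j ψ x * (a x * pdR j b x + (- b x) * pdR j a x)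
        + ψ x * (a x * pdR j (pdR j b) x - b x * pdR j (pdR j a) x) := by
    intro j
    have d1 := sψ.dif'
    have d2 := sa.dif'
    have d3 := sb.dif'
    have d4 := (hpa j).dif'
    have d5 := (hpb j).dif'
    rw [pdR_mul d1 (by fun_prop), pdR_sub (by fun_prop) (by fun_prop), pdR_mul d2 d5,
      pdR_mul d3 d4]
    ring
  have hy : ∀ j, -((2 + 2 * N₀) * δ * (m x ^ 2 * φ x * eD a b x)
        + (2 + 2 * N₀) * δ⁻¹ * (φ x * (pdR j a x ^ 2 + pdR j b x ^ 2)))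
      ≤ pdR j ψ x * (a x * pdR j b x + (- b x) * pdR j a x) := by
    intro j
    have := young_pt (a := a x) (b := - b x) (p := pdR j b x) (q := pdR j a x) (dψ j x) (hφ x)
      (by positivity) (G.mp x).le hδ
    have := neg_le_of_abs_le this
    unfold eD
    simp only [neg_sq] at this
    linarith
  have hsum : ∑ j, pdR j (fun x => ψ x * (a x * pdR j b x - b x * pdR j a x)) x
      ≥ -((2 + 2 * N₀) * d * δ * (m x ^ 2 * φ x * eD a b x)
        + (2 + 2 * N₀) * δ⁻¹ * (φ x * gD a b x))
        + ψ x * (a x * lapR b x - b x * lapR a x) := by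
    simp only [hdiv, Finset.sum_add_distrib]
    have h1 := Finset.sum_le_sum (fun j (_ : j ∈ Finset.univ) => hy j)
    have h2 : ∑ j, ψ x * (a x * pdR j (pdR j b) x - b x * pdR j (pdR j a) x)
        = ψ x * (a x * lapR b x - b x * lapR a x) := by
      rw [← Finset.mul_sum, Finset.sum_sub_distrib, ← Finset.mul_sum, ← Finset.mul_sum]; rfl
    have h3 : ∑ j : Fin d, -((2 + 2 * N₀) * δ * (m x ^ 2 * φ x * eD a b x)
        + (2 + 2 * N₀) * δ⁻¹ * (φ x * (pdR j a x ^ 2 + pdR j b x ^ 2)))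
        = -((2 + 2 * N₀) * d * δ * (m x ^ 2 * φ x * eD a b x)
        + (2 + 2 * N₀) * δ⁻¹ * (φ x * gD a b x)) := by
      rw [Finset.sum_neg_distrib, Finset.sum_add_distrib, gD, Finset.mul_sum, Finset.mul_sum]
      simp only [Finset.sum_const, Finset.card_univ, Fintype.card_fin, nsmul_eq_mul]
      ring
    linarith
  have hlast : (g [] x ^ 2 * n x ^ 2 * φ x) * eD a b x ≤
      s * fD (g []) a b x + s⁻¹ * (φ x ^ 2 * eD a b x)
      + ψ x * (a x * lapR b x - b x * lapR a x) := by
    have e : s⁻¹ * s = 1 := inv_mul_cancel₀ hs.ne'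
    have hi : 0 < s⁻¹ := inv_pos.2 hs
    have y := young_pt (C := 1) (m := φ x) (a := a x) (b := - b x)
      (q := -lapR a x - g [] x * b x) (p := -lapR b x + g [] x * a x) (c := ψ x) (φ := 1) (δ := s⁻¹)
      (by simpa using bψ x) zero_le_one zero_le_one (hφ x) hi
    have y2 := le_of_abs_le y
    rw [inv_inv] at y2
    have e3 : ψ x * (a x * (-lapR b x + g [] x * a x) + -b x * (-lapR a x - g [] x * b x))
      = (g [] x ^ 2 * n x ^ 2 * φ x) * eD a b x - ψ x * (a x * lapR b x - b x * lapR a x) := by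
      rw [hψ]; unfold eD; ring
    rw [e3] at y2
    unfold fD
    unfold eD at y2 ⊢
    linarith
  linarith [hsum, hlast]

end Analytic2

section Analytic3

variable {d : ℕ}

lemma energy_step {a b m n φ : Rd d → ℝ} {g : List (Fin d) → Rd d → ℝ} {N₀ : ℝ}
    {K : Set (Rd d)} (h : TestPair a b K) (G : Gauge g m n N₀)
    (sφ : ContDiff ℝ (⊤ : ℕ∞) φ) (hφ : ∀ x, 0 ≤ φ x)
    (dφ : ∀ j x, |pdR j φ x| ≤ m x * φ x) (l : List (Fin d)) (j : Fin d) {C δ : ℝ}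
    (hδ : 0 < δ) (hC : C = 2 + (2 * l.length + 4) * N₀ + 2) :
    ∫ x, (g (j :: l) x ^ 2 * n x ^ (2 * (j :: l).length + 2) * φ x) * eD a b x ≤
      (C * δ⁻¹) * (∫ x, (g l x ^ 2 * n x ^ (2 * l.length + 2) * φ x) * eD a b x)
      + (C * δ) * (∫ x, m x ^ 2 * φ x * eD a b x)
      + (C * δ) * (∫ x, φ x * gD a b x) := by
  have cφ := sφ.continuous
  have cm := G.ms.continuous
  have cn := G.ns.continuous
  have sn := G.ns
  have sg := G.gs
  have cg := fun l => (G.gs l).continuous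
  have hpa := fun j => h.sa.pdR' j
  have hpb := fun j => h.sb.pdR' j
  have sa := h.sa
  have sb := h.sb
  have n0 := G.n0
  set k := l.length with hk
  set η : Rd d → ℝ := fun x => g (j :: l) x * n x ^ (2 * k + 3 + 1) * φ x with hη
  have sη : ContDiff ℝ (⊤ : ℕ∞) η := by
    have := sg (j :: l)
    fun_prop
  have dη : ∀ x, |pdR j η x| ≤ (2 + (2 * k + 4) * N₀) * n x ^ k * φ x := by
    intro x
    have := eta_bound G sφ hφ dφ (j :: l) (2 * k + 3) j x
    rw [List.length_cons, ← hk, show 2 * k + 3 + 1 = k + (k + 1 + 3) by ring,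
      mn_red' (G.mn x)] at this
    rw [hη, show 2 * k + 3 + 1 = k + (k + 1 + 3) by ring]
    refine this.trans (le_of_eq ?_)
    push_cast
    ring
  have bη : ∀ x, |η x| ≤ n x ^ (k + 1) * φ x := by
    intro x
    have e0 := G.gb (j :: l) x
    have hn := abs_of_pos (G.np x)
    have hp := abs_of_nonneg (hφ x)
    have h1 := hφ x
    have h2 := G.np x
    rw [List.length_cons, ← hk] at e0
    simp only [hη, abs_mul, abs_pow, hn, hp]
    calc |g (j :: l) x| * n x ^ (2 * k + 3 + 1) * φ x
        ≤ m x ^ (k + 1 + 2) * n x ^ (2 * k + 3 + 1) * φ x := by gcongr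
      _ = _ := by rw [show 2 * k + 3 + 1 = (k + 1) + (k + 1 + 2) by ring, mn_red' (G.mn x)]
  set F₀ : Rd d → ℝ := fun x => g l x * (η x * (a x * a x + b x * b x)) with hF₀
  have sF : ContDiff ℝ (⊤ : ℕ∞) F₀ := by
    have := sg l
    fun_prop
  have key := int_le_four (F := fun i => if i = j then F₀ else fun _ => 0) h.cK (C * δ⁻¹) (C * δ)
    (C * δ) 0
    (G := fun x => (g (j :: l) x ^ 2 * n x ^ (2 * (j :: l).length + 2) * φ x) * eD a b x)
    (H₁ := fun x => (g l x ^ 2 * n x ^ (2 * k + 2) * φ x) * eD a b x)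
    (H₂ := fun x => m x ^ 2 * φ x * eD a b x) (H₃ := fun x => φ x * gD a b x)
    (H₄ := fun x => φ x * gD a b x)
     ?_ ?_ (h.ie (by have := cg (j :: l); fun_prop)) (h.ie (by have := cg l; fun_prop))
     (h.ie (by fun_prop)) (h.ig cφ) (h.ig cφ) ?_
  · simpa using key
  · intro i
    by_cases hij : i = j
    · simpa [hij] using sF
    · simpa [hij] using contDiff_const
  · intro i x hx
    by_cases hij : i = j
    · simp [hij, hF₀, h.va x hx, h.vb x hx]
    · simp [hij]
  intro x
  have hs : ∑ i, pdR i (if i = j then F₀ else fun _ => 0) x = pdR j F₀ x := by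
    rw [Finset.sum_eq_single j]
    · simp
    · intro i _ hij
      simp [hij, pdR_const]
    · simp
  rw [hs]
  have hdiv : pdR j F₀ x = (g (j :: l) x ^ 2 * n x ^ (2 * (j :: l).length + 2) * φ x) * eD a b x
      + g l x * pdR j η x * eD a b x
      + (2 * g l x * η x) * (a x * pdR j a x + b x * pdR j b x) := by
    have d0 := (sg l).dif'
    have d1 := sη.dif'
    have d2 := sa.dif'
    have d3 := sb.dif'
    rw [hF₀, pdR_mul d0 (by fun_prop), pdR_mul d1 (by fun_prop), pdR_add (by fun_prop) (by fun_prop),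
      pdR_mul d2 d2, pdR_mul d3 d3, G.gd, List.length_cons]
    simp only [hη, eD]
    ring
  have hn := G.np x
  have hp := hφ x
  have hm := G.mp x
  have hi : 0 < δ⁻¹ := inv_pos.2 hδ
  have hg0 : 0 ≤ pdR j a x ^ 2 + pdR j b x ^ 2 := by positivity
  have hgD : pdR j a x ^ 2 + pdR j b x ^ 2 ≤ gD a b x :=
    Finset.single_le_sum (f := fun j => pdR j a x ^ 2 + pdR j b x ^ 2)
      (fun i _ => by positivity) (Finset.mem_univ j)
  have he0 : 0 ≤ eD a b x := by unfold eD; positivity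
  have t2 := neg_le_of_abs_le (young_pt (C := 2) (m := |g l x| * n x ^ (k + 1)) (φ := φ x)
    (c := 2 * g l x * η x)
    (a := a x) (b := b x) (p := pdR j a x) (q := pdR j b x) (δ := δ⁻¹) (by
      rw [abs_mul, abs_mul, abs_two]
      have := mul_le_mul_of_nonneg_left (bη x) (abs_nonneg (g l x))
      linarith) hp (by norm_num) (by positivity) hi)
  rw [inv_inv, mul_pow, sq_abs] at t2
  have t1 : |g l x * pdR j η x * eD a b x| ≤ (2 + (2 * k + 4) * N₀) *
      (δ⁻¹ * ((g l x ^ 2 * n x ^ (2 * k + 2) * φ x) * eD a b x)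
        + δ * (m x ^ 2 * φ x * eD a b x)) := by
    have y : |g l x| * n x ^ k ≤ δ⁻¹ * (g l x ^ 2 * n x ^ (2 * k + 2)) + δ * m x ^ 2 := by
      have e1 : |g l x| * n x ^ k = (|g l x| * n x ^ (k + 1)) * m x := by
        calc |g l x| * n x ^ k = |g l x| * n x ^ k * (m x * n x) := by rw [G.mn x]; ring
          _ = _ := by ring
      have e2 : g l x ^ 2 * n x ^ (2 * k + 2) = (|g l x| * n x ^ (k + 1)) ^ 2 := by
        rw [mul_pow, sq_abs]; ring
      rw [e1, e2]
      generalize |g l x| * n x ^ (k + 1) = y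
      have e : δ⁻¹ * δ = 1 := inv_mul_cancel₀ hδ.ne'
      have p1 : 0 ≤ δ⁻¹ * (y - δ * m x / 2) ^ 2 := by positivity
      have p2 : δ⁻¹ * (y - δ * m x / 2) ^ 2 =
        δ⁻¹ * y ^ 2 - (δ⁻¹ * δ) * (y * m x) + (δ⁻¹ * δ) * δ * m x ^ 2 / 4 := by ring
      rw [p2, e] at p1
      have : 0 ≤ δ * m x ^ 2 := by positivity
      linarith
    rw [abs_mul, abs_mul, abs_of_nonneg he0]
    calc |g l x| * |pdR j η x| * eD a b x
        ≤ |g l x| * ((2 + (2 * k + 4) * N₀) * n x ^ k * φ x) * eD a b x := by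
          have := dη x
          gcongr
      _ = (2 + (2 * k + 4) * N₀) * ((|g l x| * n x ^ k) * (φ x * eD a b x)) := by ring
      _ ≤ (2 + (2 * k + 4) * N₀) * ((δ⁻¹ * (g l x ^ 2 * n x ^ (2 * k + 2)) + δ * m x ^ 2)
            * (φ x * eD a b x)) := by gcongr
      _ = _ := by ring
  have t1 := neg_le_of_abs_le t1
  have t3 : δ * (φ x * (pdR j a x ^ 2 + pdR j b x ^ 2)) ≤ δ * (φ x * gD a b x) := by gcongr
  have t4 : 0 ≤ δ * (m x ^ 2 * φ x * eD a b x) := by positivity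
  have t5 : 0 ≤ (2 + (2 * k + 4) * N₀) * (δ * (φ x * gD a b x)) := by
    have := hg0.trans hgD
    positivity
  have t6 : δ⁻¹ * (g l x ^ 2 * (n x ^ (k + 1)) ^ 2 * φ x * (a x ^ 2 + b x ^ 2))
    = δ⁻¹ * ((g l x ^ 2 * n x ^ (2 * k + 2) * φ x) * eD a b x) := by unfold eD; ring
  rw [t6] at t2
  rw [hdiv, hC]
  generalize g l x * pdR j η x * eD a b x = z1 at *
  generalize 2 * g l x * η x * (a x * pdR j a x + b x * pdR j b x) = z2 at *
  linarith

/-- Final estimate for the cross term. -/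
lemma cross_term {a b m n φ : Rd d → ℝ} {g : List (Fin d) → Rd d → ℝ} {N₀ : ℝ}
    {K : Set (Rd d)} (h : TestPair a b K) (G : Gauge g m n N₀)
    (sφ : ContDiff ℝ (⊤ : ℕ∞) φ) (hφm : ∀ x, m x ^ 2 ≤ φ x) :
    ∫ x, (lapR a x ^ 2 + lapR b x ^ 2 + g [] x ^ 2 * eD a b x) ≤
      (∫ x, fD (g []) a b x) + 2 * d * (∫ x, m x ^ 2 * φ x * eD a b x)
      + 2 * (∫ x, φ x * gD a b x) := by
  have cφ := sφ.continuous
  have cm := G.ms.continuous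
  have sV := G.gs []
  have cV := sV.continuous
  have hpa := fun j => h.sa.pdR' j
  have hpb := fun j => h.sb.pdR' j
  have sa := h.sa
  have sb := h.sb
  have hla := h.cla
  have hlb := h.clb
  have hce := h.ce
  have key := int_le_four
    (F := fun j x => (2 * g [] x) * (a x * pdR j b x - b x * pdR j a x)) h.cK 1 (2 * d) 2 0
    (G := fun x => lapR a x ^ 2 + lapR b x ^ 2 + g [] x ^ 2 * eD a b x)
    (H₁ := fun x => fD (g []) a b x)
    (H₂ := fun x => m x ^ 2 * φ x * eD a b x) (H₃ := fun x => φ x * gD a b x)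
    (H₄ := fun x => φ x * gD a b x)
     ?_ ?_ (integrable_cs h.cK (by fun_prop) (fun x hx => by
       simp [h.vla x hx, h.vlb x hx, h.ve x hx])) (h.jf cV)
     (h.ie (by fun_prop)) (h.ig cφ) (h.ig cφ) ?_
  · simpa using key
  · intro j
    have := hpa j
    have := hpb j
    fun_prop
  · intro j x hx
    simp [h.va x hx, h.vb x hx]
  intro x
  have hdiv : ∀ j, pdR j (fun x => (2 * g [] x) * (a x * pdR j b x - b x * pdR j a x)) x
      = (2 * g [j] x) * (a x * pdR j b x + (- b x) * pdR j a x)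
        + (2 * g [] x) * (a x * pdR j (pdR j b) x - b x * pdR j (pdR j a) x) := by
    intro j
    have d1 := sV.dif'
    have d2 := sa.dif'
    have d3 := sb.dif'
    have d4 := (hpa j).dif'
    have d5 := (hpb j).dif'
    rw [pdR_mul (by fun_prop) (by fun_prop), pdR_sub (by fun_prop) (by fun_prop), pdR_mul d2 d5,
      pdR_mul d3 d4, pdR_const_mul 2 d1, G.gd]
    ring
  have hm := G.mp x
  have he0 : 0 ≤ eD a b x := by unfold eD; positivity
  have hy : ∀ j, -(2 * (m x ^ 2 * φ x * eD a b x)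
        + 2 * (φ x * (pdR j a x ^ 2 + pdR j b x ^ 2)))
      ≤ (2 * g [j] x) * (a x * pdR j b x + (- b x) * pdR j a x) := by
    intro j
    have := young_pt (C := 2) (φ := m x ^ 2) (m := m x) (c := 2 * g [j] x) (δ := 1)
      (a := a x) (b := - b x) (p := pdR j b x) (q := pdR j a x) (by
        have := G.gb [j] x
        simp only [List.length_singleton] at this
        rw [abs_mul, abs_two]
        calc 2 * |g [j] x| ≤ 2 * m x ^ (1 + 2) := by gcongr
          _ = _ := by ring)
      (by positivity) (by norm_num) hm.le one_pos
    have := neg_le_of_abs_le this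
    simp only [neg_sq, one_mul, inv_one] at this
    have hh := hφm x
    have q1 : m x ^ 2 * m x ^ 2 * (a x ^ 2 + b x ^ 2) ≤ m x ^ 2 * φ x * (a x ^ 2 + b x ^ 2) := by
      gcongr
    have q2 : m x ^ 2 * (pdR j b x ^ 2 + pdR j a x ^ 2) ≤ φ x * (pdR j b x ^ 2 + pdR j a x ^ 2) := by
      gcongr
    unfold eD
    linarith
  have hsum : ∑ j, pdR j (fun x => (2 * g [] x) * (a x * pdR j b x - b x * pdR j a x)) x
      ≥ -(2 * d * (m x ^ 2 * φ x * eD a b x) + 2 * (φ x * gD a b x))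
        + (2 * g [] x) * (a x * lapR b x - b x * lapR a x) := by
    simp only [hdiv, Finset.sum_add_distrib]
    have h1 := Finset.sum_le_sum (fun j (_ : j ∈ Finset.univ) => hy j)
    have h2 : ∑ j, (2 * g [] x) * (a x * pdR j (pdR j b) x - b x * pdR j (pdR j a) x)
        = (2 * g [] x) * (a x * lapR b x - b x * lapR a x) := by
      rw [← Finset.mul_sum, Finset.sum_sub_distrib, ← Finset.mul_sum, ← Finset.mul_sum]; rfl
    have h3 : ∑ j : Fin d, -(2 * (m x ^ 2 * φ x * eD a b x)
        + 2 * (φ x * (pdR j a x ^ 2 + pdR j b x ^ 2)))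
        = -(2 * d * (m x ^ 2 * φ x * eD a b x) + 2 * (φ x * gD a b x)) := by
      rw [Finset.sum_neg_distrib, Finset.sum_add_distrib, gD, Finset.mul_sum, Finset.mul_sum]
      simp only [Finset.sum_const, Finset.card_univ, Fintype.card_fin, nsmul_eq_mul]
      ring
    linarith
  have e : fD (g []) a b x = lapR a x ^ 2 + lapR b x ^ 2 + g [] x ^ 2 * eD a b x
      - (2 * g [] x) * (a x * lapR b x - b x * lapR a x) := by
    unfold fD eD; ring
  rw [e]
  linarith

/-- Second derivatives are controlled by the Laplacian. -/
lemma hess_le {a b : Rd d → ℝ} {K : Set (Rd d)} (h : TestPair a b K) (j l : Fin d) :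
    ∫ x, (pdR j (pdR l a) x ^ 2 + pdR j (pdR l b) x ^ 2) ≤
      ∫ x, (lapR a x ^ 2 + lapR b x ^ 2) := by
  have vv : ∀ {f : Rd d → ℝ} (_ : ∀ x ∉ K, f x = 0) (j : Fin d), ∀ x ∉ K, pdR j f x = 0 :=
    fun hf j => pdR_vanish h.cK.isClosed hf j
  have one : ∀ a : Rd d → ℝ, ContDiff ℝ (⊤ : ℕ∞) a → (∀ x ∉ K, a x = 0) →
      Integrable (fun x => pdR j (pdR l a) x ^ 2) ∧ Integrable (fun x => lapR a x ^ 2) ∧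
      ∫ x, pdR j (pdR l a) x ^ 2 ≤ ∫ x, lapR a x ^ 2 := by
    intro a sa va
    have tp : TestPair a a K := ⟨h.cK, sa, sa, va, va⟩
    have s1 := fun i => sa.pdR' i
    have s2 := fun i k => (s1 i).pdR' k
    have i1 : ∀ i k, Integrable (fun x => pdR i (pdR k a) x ^ 2) := fun i k => by
      have := (s2 k i).continuous
      exact integrable_cs h.cK (by fun_prop) (fun x hx => by simp [vv (vv va k) i x hx])
    have i3 : ∀ i k, Integrable (fun x => pdR i (pdR i a) x * pdR k (pdR k a) x) := fun i k => by
      have := (s2 i i).continuous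
      have := (s2 k k).continuous
      exact integrable_cs h.cK (by fun_prop) (fun x hx => by simp [vv (vv va k) k x hx])
    have i2 : Integrable (fun x => lapR a x ^ 2) := by
      have := tp.cla
      exact integrable_cs h.cK (by fun_prop) (fun x hx => by simp [tp.vla x hx])
    refine ⟨i1 j l, i2, ?_⟩
    have eq : ∀ i k, ∫ x, pdR i (pdR k a) x ^ 2
        = ∫ x, pdR i (pdR i a) x * pdR k (pdR k a) x := by
      intro i k
      have t1 := s1 k
      have t2 := s2 k i
      have t3 := s2 i i
      have e1 := integral_pdR h.cK (f := fun x => pdR k a x * pdR i (pdR k a) x) (by fun_prop)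
        (fun x hx => by simp [vv va k x hx]) i
      have e2 := integral_pdR h.cK (f := fun x => pdR k a x * pdR i (pdR i a) x) (by fun_prop)
        (fun x hx => by simp [vv va k x hx]) k
      have j1 : Integrable (fun x => pdR k a x * pdR i (pdR i (pdR k a)) x) := by
        have := t1.continuous
        have := (t2.pdR' i).continuous
        exact integrable_cs h.cK (by fun_prop) (fun x hx => by simp [vv va k x hx])
      have c : ∀ x, pdR k (pdR i (pdR i a)) x = pdR i (pdR i (pdR k a)) x := by
        intro x
        rw [pdR_comm (s1 i) k i, pdR_comm sa k i]
      have r1 : ∀ x, pdR i (fun x => pdR k a x * pdR i (pdR k a) x) x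
          = pdR i (pdR k a) x ^ 2 + pdR k a x * pdR i (pdR i (pdR k a)) x := by
        intro x
        rw [pdR_mul t1.dif' t2.dif']; ring
      have r2 : ∀ x, pdR k (fun x => pdR k a x * pdR i (pdR i a) x) x
          = pdR i (pdR i a) x * pdR k (pdR k a) x + pdR k a x * pdR i (pdR i (pdR k a)) x := by
        intro x
        rw [pdR_mul t1.dif' t3.dif', c]; ring
      simp only [r1] at e1
      simp only [r2] at e2
      rw [integral_add (i1 i k) j1] at e1
      rw [integral_add (i3 i k) j1] at e2
      linarith
    have tot : ∫ x, lapR a x ^ 2 = ∑ i, ∑ k, ∫ x, pdR i (pdR k a) x ^ 2 := by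
      simp only [eq]
      have : ∀ x, lapR a x ^ 2 = ∑ i, ∑ k, pdR i (pdR i a) x * pdR k (pdR k a) x := by
        intro x
        rw [lapR, sq, Finset.sum_mul_sum]
      simp only [this]
      rw [integral_finsetSum _ (fun i _ => integrable_finsetSum _ (fun k _ => i3 i k))]
      refine Finset.sum_congr rfl (fun i _ => ?_)
      rw [integral_finsetSum _ (fun k _ => i3 i k)]
    rw [tot]
    have nn : ∀ i k, 0 ≤ ∫ x, pdR i (pdR k a) x ^ 2 := fun i k =>
      integral_nonneg (fun x => by positivity)
    exact (Finset.single_le_sum (f := fun k => ∫ x, pdR j (pdR k a) x ^ 2)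
      (fun k _ => nn j k) (Finset.mem_univ l)).trans
      (Finset.single_le_sum (f := fun i => ∑ k, ∫ x, pdR i (pdR k a) x ^ 2)
      (fun i _ => Finset.sum_nonneg (fun k _ => nn i k)) (Finset.mem_univ j))
  obtain ⟨p1, p2, p3⟩ := one a h.sa h.va
  obtain ⟨q1, q2, q3⟩ := one b h.sb h.vb
  rw [integral_add p1 q1, integral_add p2 q2]
  linarith

end Analytic3

section Combine

variable {d : ℕ}

/-- Slowly varying weight. -/
structure Weight (m φ : Rd d → ℝ) (ε : ℝ) : Prop where
  s : ContDiff ℝ (⊤ : ℕ∞) φ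
  nn : ∀ x, 0 ≤ φ x
  dd : ∀ j x, |pdR j φ x| ≤ ε * m x * φ x

def Qv (g : List (Fin d) → Rd d → ℝ) (n φ a b : Rd d → ℝ) (l : List (Fin d)) : ℝ :=
  ∫ x, (g l x ^ 2 * n x ^ (2 * l.length + 2) * φ x) * eD a b x

def Mv (m φ a b : Rd d → ℝ) : ℝ := ∫ x, m x ^ 2 * φ x * eD a b x

def Av (φ a b : Rd d → ℝ) : ℝ := ∫ x, φ x * gD a b x

def Bv (φ a b : Rd d → ℝ) : ℝ := ∫ x, φ x ^ 2 * eD a b x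

lemma eD_nonneg (a b : Rd d → ℝ) (x : Rd d) : 0 ≤ eD a b x := by unfold eD; positivity

lemma gD_nonneg (a b : Rd d → ℝ) (x : Rd d) : 0 ≤ gD a b x := by
  unfold gD; exact Finset.sum_nonneg (fun _ _ => by positivity)

lemma Mv_nonneg {m φ : Rd d → ℝ} {ε : ℝ} (w : Weight m φ ε) (a b : Rd d → ℝ) : 0 ≤ Mv m φ a b :=
  integral_nonneg (fun x => by have := w.nn x; have := eD_nonneg a b x; simp only [Pi.zero_apply]; positivity)

lemma Av_nonneg {m φ : Rd d → ℝ} {ε : ℝ} (w : Weight m φ ε) (a b : Rd d → ℝ) : 0 ≤ Av φ a b :=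
  integral_nonneg (fun x => by have := w.nn x; have := gD_nonneg a b x; simp only [Pi.zero_apply]; positivity)

lemma fD_int_nonneg (V a b : Rd d → ℝ) : 0 ≤ ∫ x, fD V a b x :=
  integral_nonneg (fun x => by unfold fD; simp only [Pi.zero_apply]; positivity)

lemma Q_induct {m n : Rd d → ℝ} {g : List (Fin d) → Rd d → ℝ} {N₀ : ℝ} (G : Gauge g m n N₀)
    (l : List (Fin d)) : ∀ δ : ℝ, 0 < δ → ∃ C : ℝ, 0 ≤ C ∧ ∀ (φ a b : Rd d → ℝ) (K : Set (Rd d)),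
      Weight m φ 1 → TestPair a b K →
      Qv g n φ a b l ≤ C * Qv g n φ a b [] + δ * (Mv m φ a b + Av φ a b) := by
  induction l with
  | nil =>
    intro δ hδ
    refine ⟨1, zero_le_one, fun φ a b K w h => ?_⟩
    have := Mv_nonneg w a b
    have := Av_nonneg w a b
    have : 0 ≤ δ * (Mv m φ a b + Av φ a b) := by positivity
    linarith
  | cons j l ih =>
    intro δ hδ
    have n0 := G.n0
    obtain ⟨C', hC'⟩ : ∃ C' : ℝ, C' = 2 + (2 * l.length + 4) * N₀ + 2 := ⟨_, rfl⟩
    have hpos : 0 < C' := by rw [hC']; positivity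
    obtain ⟨σ, hσ⟩ : ∃ σ : ℝ, σ = δ / (2 * C') := ⟨_, rfl⟩
    have hσ0 : 0 < σ := by rw [hσ]; positivity
    obtain ⟨C, hC, hh⟩ := ih (δ / (2 * (C' * σ⁻¹))) (by positivity)
    refine ⟨C' * σ⁻¹ * C, by positivity, fun φ a b K w h => ?_⟩
    have h1 := energy_step h G w.s w.nn (fun j x => by simpa using w.dd j x) l j hσ0 hC'
    have h2 := hh φ a b K w h
    change Qv g n φ a b (j :: l) ≤ C' * σ⁻¹ * Qv g n φ a b l + C' * σ * Mv m φ a b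
      + C' * σ * Av φ a b at h1
    have h3 := mul_le_mul_of_nonneg_left h2 (show 0 ≤ C' * σ⁻¹ by positivity)
    have e1 : C' * σ⁻¹ * (δ / (2 * (C' * σ⁻¹))) = δ / 2 := by field_simp
    have e2 : C' * σ = δ / 2 := by rw [hσ]; field_simp
    have e3 : C' * σ⁻¹ * (C * Qv g n φ a b [] + δ / (2 * (C' * σ⁻¹)) * (Mv m φ a b + Av φ a b))
      = C' * σ⁻¹ * C * Qv g n φ a b [] +
        C' * σ⁻¹ * (δ / (2 * (C' * σ⁻¹))) * (Mv m φ a b + Av φ a b) := by ring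
    rw [e3, e1] at h3
    rw [e2] at h1
    linarith

lemma M_le_Q {m n : Rd d → ℝ} {g : List (Fin d) → Rd d → ℝ} {N₀ : ℝ} (G : Gauge g m n N₀)
    (S : Finset (List (Fin d)))
    (h4 : ∀ x, m x ^ 2 ≤ ∑ l ∈ S, g l x ^ 2 * n x ^ (2 * l.length + 2)) :
    ∃ C : ℝ, 0 ≤ C ∧ ∀ (φ a b : Rd d → ℝ) (K : Set (Rd d)),
      Weight m φ 1 → TestPair a b K →
      Mv m φ a b ≤ C * Qv g n φ a b [] + Av φ a b := by
  choose C hC hh using fun l => Q_induct G l (1 / (2 * (S.card + 1))) (by positivity)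
  refine ⟨2 * ∑ l ∈ S, C l, by have := Finset.sum_nonneg (fun l (_ : l ∈ S) => hC l); positivity,
    fun φ a b K w h => ?_⟩
  have cm := G.ms.continuous
  have cn := G.ns.continuous
  have cφ := w.s.continuous
  have cg := fun l => (G.gs l).continuous
  have hM : Mv m φ a b ≤ ∑ l ∈ S, Qv g n φ a b l := by
    unfold Mv Qv
    have hi : ∀ l ∈ S, Integrable
        (fun x => (g l x ^ 2 * n x ^ (2 * l.length + 2) * φ x) * eD a b x) :=
      fun l _ => h.ie (by have := cg l; fun_prop)
    rw [← integral_finsetSum _ hi]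
    refine integral_mono (h.ie (by fun_prop)) (integrable_finsetSum _ hi) (fun x => ?_)
    have h1 := w.nn x
    have h2 := eD_nonneg a b x
    calc m x ^ 2 * φ x * eD a b x ≤
        (∑ l ∈ S, g l x ^ 2 * n x ^ (2 * l.length + 2)) * φ x * eD a b x := by
          have := h4 x
          gcongr
      _ = _ := by rw [Finset.sum_mul, Finset.sum_mul]
  have h5 : ∑ l ∈ S, Qv g n φ a b l ≤ ∑ l ∈ S, (C l * Qv g n φ a b [] +
      (1 / (2 * (S.card + 1))) * (Mv m φ a b + Av φ a b)) :=
    Finset.sum_le_sum (fun l _ => hh l φ a b K w h)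
  rw [Finset.sum_add_distrib, ← Finset.sum_mul, Finset.sum_const, nsmul_eq_mul] at h5
  have hX : 0 ≤ Mv m φ a b + Av φ a b := add_nonneg (Mv_nonneg w a b) (Av_nonneg w a b)
  have h6 : (S.card : ℝ) * (1 / (2 * (S.card + 1)) * (Mv m φ a b + Av φ a b))
      ≤ 1 / 2 * (Mv m φ a b + Av φ a b) := by
    rw [← mul_assoc]
    refine mul_le_mul_of_nonneg_right ?_ hX
    rw [mul_one_div, div_le_div_iff₀ (by positivity) (by norm_num)]
    linarith
  linarith

lemma M_le {m n : Rd d → ℝ} {g : List (Fin d) → Rd d → ℝ} {N₀ : ℝ} (G : Gauge g m n N₀)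
    (S : Finset (List (Fin d)))
    (h4 : ∀ x, m x ^ 2 ≤ ∑ l ∈ S, g l x ^ 2 * n x ^ (2 * l.length + 2)) :
    ∃ C : ℝ, 0 < C ∧ ∀ (φ a b : Rd d → ℝ) (K : Set (Rd d)) (s : ℝ),
      Weight m φ 1 → TestPair a b K → 0 < s →
      Mv m φ a b ≤ C * (s * (∫ x, fD (g []) a b x) + s⁻¹ * Bv φ a b + Av φ a b) := by
  obtain ⟨C, hC, hh⟩ := M_le_Q G S h4
  have n0 := G.n0
  obtain ⟨c, hc⟩ : ∃ c : ℝ, c = 2 + 2 * N₀ := ⟨_, rfl⟩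
  have hc0 : 0 < c := by rw [hc]; positivity
  obtain ⟨δ, hδ⟩ : ∃ δ : ℝ, δ = 1 / (2 * (C * c * d + 1)) := ⟨_, rfl⟩
  have hδ0 : 0 < δ := by rw [hδ]; positivity
  refine ⟨2 * C + 2 * C * (c * δ⁻¹) + 2, by positivity, fun φ a b K s w h hs => ?_⟩
  have h1 := hh φ a b K w h
  have h2 := energy_im h G w.s w.nn (fun j x => by simpa using w.dd j x) hs hδ0
  rw [← hc] at h2
  change Qv g n φ a b [] ≤ s * (∫ x, fD (g []) a b x) + s⁻¹ * Bv φ a b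
    + (c * d * δ) * Mv m φ a b + (c * δ⁻¹) * Av φ a b at h2
  have hM := Mv_nonneg w a b
  have hA := Av_nonneg w a b
  have hB : 0 ≤ Bv φ a b := integral_nonneg (fun x => by
    have := eD_nonneg a b x; simp only [Pi.zero_apply]; positivity)
  have hN := fD_int_nonneg (g []) a b
  have hX : 0 ≤ s * (∫ x, fD (g []) a b x) + s⁻¹ * Bv φ a b := by positivity
  generalize s * (∫ x, fD (g []) a b x) + s⁻¹ * Bv φ a b = X at *
  generalize Mv m φ a b = M at *
  generalize Av φ a b = A at *
  generalize Qv g n φ a b [] = Q at *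
  have h3 := mul_le_mul_of_nonneg_left h2 hC
  have e : C * c * d * δ ≤ 1 / 2 := by
    rw [hδ, mul_one_div, div_le_div_iff₀ (by positivity) (by norm_num)]
    linarith
  have h5 := mul_le_mul_of_nonneg_right e hM
  have p1 : 0 ≤ 2 * C * (c * δ⁻¹) * X := by positivity
  have p2 : 0 ≤ C * A := by positivity
  nlinarith

theorem max_est {m n : Rd d → ℝ} {g : List (Fin d) → Rd d → ℝ} {N₀ : ℝ} (G : Gauge g m n N₀)
    (S : Finset (List (Fin d)))
    (h4 : ∀ x, m x ^ 2 ≤ ∑ l ∈ S, g l x ^ 2 * n x ^ (2 * l.length + 2))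
    (hw : ∀ ε : ℝ, 0 < ε → ∃ (φ : Rd d → ℝ) (L : ℝ), 0 < L ∧ Weight m φ ε ∧
      (∀ x, m x ^ 2 ≤ φ x) ∧ ∀ x, φ x ≤ L * m x ^ 2) :
    ∃ C : ℝ, 0 < C ∧ ∀ (a b : Rd d → ℝ) (K : Set (Rd d)), TestPair a b K →
      ∫ x, (lapR a x ^ 2 + lapR b x ^ 2 + g [] x ^ 2 * eD a b x) ≤ C * ∫ x, fD (g []) a b x := by
  obtain ⟨C₃, hC₃, hM⟩ := M_le G S h4
  obtain ⟨ε, hε⟩ : ∃ ε : ℝ, ε = 1 / (4 * (C₃ * d + 1)) := ⟨_, rfl⟩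
  have hε0 : 0 < ε := by rw [hε]; positivity
  have hε1 : ε ≤ 1 / 4 := by
    rw [hε, div_le_div_iff₀ (by positivity) (by norm_num)]
    have : 0 ≤ C₃ * d := by positivity
    linarith
  have hε2 : ε * d * C₃ ≤ 1 / 4 := by
    rw [hε, one_div, inv_mul_eq_div, div_mul_eq_mul_div, div_le_div_iff₀ (by positivity) (by norm_num)]
    linarith
  obtain ⟨φ, L, hL, w, hφ1, hφ2⟩ := hw ε hε0
  have w1 : Weight m φ 1 := ⟨w.s, w.nn, fun j x => (w.dd j x).trans (by
    have := w.nn x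
    have := (G.mp x).le
    gcongr
    linarith)⟩
  obtain ⟨C₄, hC₄⟩ : ∃ C₄ : ℝ, C₄ = 5 / 2 + 7 / 2 * C₃ := ⟨_, rfl⟩
  have hC40 : 0 < C₄ := by rw [hC₄]; positivity
  obtain ⟨s, hs⟩ : ∃ s : ℝ, s = 2 * C₄ * L := ⟨_, rfl⟩
  have hs0 : 0 < s := by rw [hs]; positivity
  refine ⟨1 + (2 * d + 2) * (2 * C₄ * s), by positivity, fun a b K h => ?_⟩
  have h1 := hM φ a b K s w1 h hs0
  have h2 := energy_re h (G.gs []).continuous G.ms.continuous (fun x => (G.mp x).le) w.s w.nn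
    hε0.le w.dd hs0
  have h3 := cross_term h G w.s hφ1
  have cm := G.ms.continuous
  have cφ := w.s.continuous
  have hBM : Bv φ a b ≤ L * Mv m φ a b := by
    unfold Bv Mv
    rw [← integral_const_mul]
    refine integral_mono (h.ie (by fun_prop)) ((h.ie (by fun_prop)).const_mul _) (fun x => ?_)
    have := w.nn x
    have := eD_nonneg a b x
    have := hφ2 x
    calc φ x ^ 2 * eD a b x = φ x * φ x * eD a b x := by ring
      _ ≤ (L * m x ^ 2) * φ x * eD a b x := by gcongr
      _ = _ := by ring
  change Av φ a b ≤ s * (∫ x, fD (g []) a b x) + s⁻¹ * Bv φ a b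
      + (ε * d) * Mv m φ a b + ε * Av φ a b at h2
  change _ ≤ (∫ x, fD (g []) a b x) + 2 * d * Mv m φ a b + 2 * Av φ a b at h3
  refine h3.trans ?_
  have hM0 := Mv_nonneg w a b
  have hA0 := Av_nonneg w a b
  have hB0 : 0 ≤ Bv φ a b := integral_nonneg (fun x => by
    have := eD_nonneg a b x; simp only [Pi.zero_apply]; positivity)
  have hN0 := fD_int_nonneg (g []) a b
  generalize (∫ x, fD (g []) a b x) = N at *
  generalize Mv m φ a b = M at *
  generalize Av φ a b = A at *
  generalize Bv φ a b = B at *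
  have hX : 0 ≤ s * N + s⁻¹ * B := by positivity
  obtain ⟨X, hXe⟩ : ∃ X : ℝ, X = s * N + s⁻¹ * B := ⟨_, rfl⟩
  rw [← hXe] at h1 h2 hX
  have t1 : ε * d * M ≤ 1 / 4 * (X + A) := by
    have := mul_le_mul_of_nonneg_left h1 (show 0 ≤ ε * d by positivity)
    have := mul_le_mul_of_nonneg_right hε2 (show 0 ≤ X + A by positivity)
    linarith
  have t2 : ε * A ≤ 1 / 4 * A := by gcongr
  have t3 : A ≤ 5 / 2 * X := by linarith
  have t4 : A + M ≤ C₄ * X := by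
    have := mul_le_mul_of_nonneg_left t3 hC₃.le
    rw [hC₄]; linarith
  have t5 : C₄ * (s⁻¹ * B) ≤ M / 2 := by
    have : C₄ * (s⁻¹ * (L * M)) = M / 2 := by rw [hs]; field_simp
    rw [← this]; gcongr
  have t6 : A + M ≤ 2 * C₄ * s * N := by
    rw [hXe] at t4
    linarith
  have hd : (0:ℝ) ≤ d := by positivity
  have t7 := mul_le_mul_of_nonneg_left t6 (show (0:ℝ) ≤ 2 * d + 2 by positivity)
  have : 0 ≤ d * A := by positivity
  linarith

end Combine

section Poly

variable {d : ℕ}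

/-- Iterated formal partial derivatives. -/
def gp (V : MvPolynomial (Fin d) ℝ) : List (Fin d) → MvPolynomial (Fin d) ℝ
  | [] => V
  | j :: l => MvPolynomial.pderiv j (gp V l)

def gf (V : MvPolynomial (Fin d) ℝ) (l : List (Fin d)) (x : Rd d) : ℝ :=
  MvPolynomial.eval (fun i => x i) (gp V l)

lemma eval_smooth (p : MvPolynomial (Fin d) ℝ) :
    ContDiff ℝ (⊤ : ℕ∞) (fun x : Rd d => MvPolynomial.eval (fun i => x i) p) := by
  induction p using MvPolynomial.induction_on with
  | C c => simpa using contDiff_const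
  | add p q hp hq => simpa using hp.add hq
  | mul_X p i hp =>
    simp only [map_mul, MvPolynomial.eval_X]
    refine hp.mul ?_
    fun_prop

lemma pdR_coord (i j : Fin d) (x : Rd d) :
    pdR j (fun x : Rd d => x i) x = if i = j then 1 else 0 := by
  unfold pdR
  have : (fun x : Rd d => x i) = (EuclideanSpace.proj i : Rd d →L[ℝ] ℝ) := by
    funext x; simp
  rw [this, ContinuousLinearMap.fderiv]
  simp [Pi.single_apply]

lemma pdR_eval (p : MvPolynomial (Fin d) ℝ) (j : Fin d) (x : Rd d) :
    pdR j (fun x : Rd d => MvPolynomial.eval (fun i => x i) p) x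
      = MvPolynomial.eval (fun i => x i) (MvPolynomial.pderiv j p) := by
  induction p using MvPolynomial.induction_on with
  | C c => simp [pdR_const]
  | add p q hp hq =>
    simp only [map_add]
    rw [pdR_add (eval_smooth p).dif' (eval_smooth q).dif', hp, hq]
  | mul_X p i hp =>
    have : Differentiable ℝ (fun x : Rd d => x i) := by fun_prop
    simp only [map_mul, MvPolynomial.eval_X]
    rw [pdR_mul (eval_smooth p).dif' this, hp, pdR_coord, Derivation.leibniz, MvPolynomial.pderiv_X]
    by_cases h : i = j
    · subst h; simp; ring
    · simp [h, Pi.single_apply]; ring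

lemma gp_coeff (V : MvPolynomial (Fin d) ℝ) (l : List (Fin d)) :
    ∀ k : Fin d →₀ ℕ, MvPolynomial.coeff k (gp V l) ≠ 0 →
      ∃ k' : Fin d →₀ ℕ, MvPolynomial.coeff k' V ≠ 0 ∧ k'.degree = k.degree + l.length := by
  induction l with
  | nil => intro k hk; exact ⟨k, hk, by simp⟩
  | cons j l ih =>
    intro k hk
    rw [gp, MvPolynomial.coeff_pderiv] at hk
    obtain ⟨k', h1, h2⟩ := ih _ (left_ne_zero_of_mul hk)
    refine ⟨k', h1, ?_⟩
    rw [h2, map_add, Finsupp.degree_single, List.length_cons]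
    ring

lemma gp_zero (V : MvPolynomial (Fin d) ℝ) (l : List (Fin d)) (h : V.totalDegree < l.length) :
    gp V l = 0 := by
  by_contra hne
  obtain ⟨k, hk⟩ := MvPolynomial.ne_zero_iff.1 hne
  obtain ⟨k', h1, h2⟩ := gp_coeff V l k hk
  have := MvPolynomial.le_totalDegree (MvPolynomial.mem_support_iff.2 h1)
  rw [Finsupp.sum, ← Finsupp.degree_apply] at this
  omega

lemma exists_top (V : MvPolynomial (Fin d) ℝ) (hV : V ≠ 0) :
    ∃ r : ℕ, (∀ l : List (Fin d), r < l.length → gp V l = 0) ∧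
      ∃ l : List (Fin d), l.length = r ∧ ∀ x, gf V l x ≠ 0 := by
  classical
  let P : ℕ → Prop := fun r => ∃ l : List (Fin d), l.length = r ∧ gp V l ≠ 0
  have h0 : P 0 := ⟨[], rfl, hV⟩
  have hb : ∀ r, P r → r ≤ V.totalDegree := by
    rintro r ⟨l, hl, hne⟩
    by_contra hlt
    exact hne (gp_zero V l (by omega))
  set r := Nat.findGreatest P V.totalDegree with hr
  have hPr : P r := Nat.findGreatest_spec (Nat.zero_le _) h0
  have hmax : ∀ l : List (Fin d), r < l.length → gp V l = 0 := by
    intro l hl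
    by_contra hne
    have hp : P l.length := ⟨l, rfl, hne⟩
    have := Nat.le_findGreatest (hb _ hp) hp
    omega
  refine ⟨r, hmax, ?_⟩
  obtain ⟨l, hl, hne⟩ := hPr
  refine ⟨l, hl, ?_⟩
  have hd : ∀ j x, pdR j (gf V l) x = 0 := by
    intro j x
    have := pdR_eval (gp V l) j x
    have h2 : MvPolynomial.pderiv j (gp V l) = 0 := hmax (j :: l) (by simp [hl])
    rw [h2, map_zero] at this
    exact this
  have hdiff : Differentiable ℝ (gf V l) := (eval_smooth (gp V l)).dif'
  have hf : ∀ x, fderiv ℝ (gf V l) x = 0 := by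
    intro x
    ext v
    have hv : v = ∑ j, v j • EuclideanSpace.single j (1:ℝ) := by
      ext i
      simp [Finset.sum_apply, Pi.single_apply]
    rw [hv, map_sum]
    simp only [map_smul]
    simp only [pdR] at hd
    simp [hd]
  intro x hx
  apply hne
  apply MvPolynomial.funext
  intro y
  have := is_const_of_fderiv_eq_zero hdiff hf (WithLp.toLp 2 y) x
  rw [hx] at this
  simpa [gf] using this

end Poly

section GaugeC

variable {d : ℕ}

def qq (r k : ℕ) : ℕ := Nat.factorial (r + 2) / (k + 2)
def pp (r : ℕ) : ℕ := 2 * Nat.factorial (r + 2)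

lemma pp_pos (r : ℕ) : 0 < pp r := by unfold pp; have := Nat.factorial_pos (r + 2); omega

lemma qq_spec {r k : ℕ} (h : k ≤ r) : (k + 2) * (2 * qq r k) = pp r := by
  have : (k + 2) * qq r k = Nat.factorial (r + 2) :=
    Nat.mul_div_cancel' (Nat.dvd_factorial (by omega) (by omega))
  unfold pp; rw [← this]; ring

lemma qq_pos {r k : ℕ} (h : k ≤ r) : 0 < qq r k := by
  have h1 := qq_spec h
  have h2 := pp_pos r
  rcases Nat.eq_zero_or_pos (qq r k) with h3 | h3
  · rw [h3] at h1; omega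
  · exact h3

def Wt (g : List (Fin d) → Rd d → ℝ) (r : ℕ) (S : Finset (List (Fin d))) (K : ℝ) (x : Rd d) : ℝ :=
  ∑ l ∈ S, (K ^ l.length * g l x) ^ (2 * qq r l.length)

/-- The smooth, homogeneous gauge with its basic properties. -/
structure Wprop (g : List (Fin d) → Rd d → ℝ) (r : ℕ) (S : Finset (List (Fin d))) (K : ℝ)
    (w : Rd d → ℝ) : Prop where
  s : ContDiff ℝ (⊤ : ℕ∞) w
  p : ∀ x, 0 < w x
  e : ∀ x, w x ^ pp r = Wt g r S K x
  b : ∀ l x, |K ^ l.length * g l x| ≤ w x ^ (l.length + 2)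
  dd : ∀ j x, |pdR j w x| ≤ S.card / K * w x ^ 2

lemma exists_w {g : List (Fin d) → Rd d → ℝ} {r : ℕ} {S : Finset (List (Fin d))} {K : ℝ}
    (hK : 0 < K) (gs : ∀ l, ContDiff ℝ (⊤ : ℕ∞) (g l))
    (gd : ∀ j l x, pdR j (g l) x = g (j :: l) x)
    (hz : ∀ l, r < l.length → ∀ x, g l x = 0)
    (hS : ∀ l, l ∈ S ↔ l.length ≤ r)
    {l0 : List (Fin d)} (hl0 : l0.length ≤ r) (hne : ∀ x, g l0 x ≠ 0) :
    ∃ w, Wprop g r S K w := by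
  have Wnn : ∀ l x, 0 ≤ (K ^ l.length * g l x) ^ (2 * qq r l.length) := fun l x => by
    rw [pow_mul]; positivity
  have Wle : ∀ l ∈ S, ∀ x, (K ^ l.length * g l x) ^ (2 * qq r l.length) ≤ Wt g r S K x :=
    fun l hl x => Finset.single_le_sum (f := fun l => (K ^ l.length * g l x) ^ (2 * qq r l.length))
      (fun l _ => Wnn l x) hl
  have Wpos : ∀ x, 0 < Wt g r S K x := by
    intro x
    refine lt_of_lt_of_le ?_ (Wle l0 ((hS l0).2 hl0) x)
    rw [pow_mul]
    have := hne x
    positivity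
  have Ws : ContDiff ℝ (⊤ : ℕ∞) (Wt g r S K) := by
    unfold Wt
    exact ContDiff.sum (fun l _ => (contDiff_const.mul (gs l)).pow _)
  have hp := pp_pos r
  have hpR : (0 : ℝ) < pp r := by exact_mod_cast hp
  have hs : ContDiff ℝ (⊤ : ℕ∞) (fun x => Wt g r S K x ^ (1 / (pp r : ℝ))) :=
    Ws.rpow_const_of_ne (fun x => (Wpos x).ne')
  have hpos : ∀ x, 0 < Wt g r S K x ^ (1 / (pp r : ℝ)) := fun x => Real.rpow_pos_of_pos (Wpos x) _
  have he : ∀ x, (Wt g r S K x ^ (1 / (pp r : ℝ))) ^ pp r = Wt g r S K x := by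
    intro x
    rw [← Real.rpow_natCast, ← Real.rpow_mul (Wpos x).le]
    field_simp
    simp
  generalize hw : (fun x => Wt g r S K x ^ (1 / (pp r : ℝ))) = w at hs
  have hw' : ∀ x, Wt g r S K x ^ (1 / (pp r : ℝ)) = w x := fun x => congrFun hw x
  simp only [hw'] at hpos he
  have hb : ∀ l x, |K ^ l.length * g l x| ≤ w x ^ (l.length + 2) := by
    intro l x
    by_cases hl : l ∈ S
    · have hlr := (hS l).1 hl
      have hq := qq_pos hlr
      have h1 := Wle l hl x
      rw [← he x, ← qq_spec hlr, pow_mul (w x)] at h1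
      have h2 : |K ^ l.length * g l x| ^ (2 * qq r l.length)
          = (K ^ l.length * g l x) ^ (2 * qq r l.length) := by
        rw [pow_mul, sq_abs, ← pow_mul]
      rw [← h2] at h1
      have hw0 := (hpos x).le
      exact le_of_pow_le_pow_left₀ (by omega) (by positivity) h1
    · have : r < l.length := by
        by_contra h
        exact hl ((hS l).2 (by omega))
      rw [hz l this x, mul_zero, abs_zero]
      have := hpos x
      positivity
  refine ⟨w, hs, hpos, he, hb, ?_⟩
  intro j x
  have hwx := hpos x
  have h1 : pdR j (Wt g r S K) x = pp r * w x ^ (pp r - 1) * pdR j w x := by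
    have : Wt g r S K = fun y => w y ^ pp r := funext fun y => (he y).symm
    rw [this, pdR_pow hs.dif']
  have h2 : pdR j (Wt g r S K) x = ∑ l ∈ S, ((2 * qq r l.length : ℕ) : ℝ)
      * (K ^ l.length * g l x) ^ (2 * qq r l.length - 1) * (K ^ l.length * g (j :: l) x) := by
    unfold Wt
    rw [pdR_sum S (fun l _ => ((contDiff_const.mul (gs l)).pow _).dif')]
    refine Finset.sum_congr rfl fun l _ => ?_
    rw [pdR_pow (contDiff_const.mul (gs l)).dif', pdR_const_mul _ (gs l).dif', gd]
  have h3 : ∀ l ∈ S, |((2 * qq r l.length : ℕ) : ℝ)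
      * (K ^ l.length * g l x) ^ (2 * qq r l.length - 1) * (K ^ l.length * g (j :: l) x)|
      ≤ pp r * w x ^ (pp r + 1) / K := by
    intro l hl
    have hlr := (hS l).1 hl
    have hq := qq_pos hlr
    have hsp := qq_spec hlr
    set k := l.length with hk
    rw [abs_mul, abs_mul, abs_pow, Nat.abs_cast]
    have e1 : |K ^ k * g l x| ^ (2 * qq r k - 1) ≤ (w x ^ (k + 2)) ^ (2 * qq r k - 1) :=
      pow_le_pow_left₀ (abs_nonneg _) (hb l x) _
    have e2 : |K ^ k * g (j :: l) x| ≤ w x ^ (k + 3) / K := by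
      rw [le_div_iff₀ hK]
      have := hb (j :: l) x
      rw [List.length_cons, ← hk] at this
      calc |K ^ k * g (j :: l) x| * K = |K ^ (k + 1) * g (j :: l) x| := by
            rw [pow_succ, abs_mul, abs_mul, abs_mul, abs_of_pos hK]; ring
        _ ≤ _ := this
    have e3 : ((2 * qq r k : ℕ) : ℝ) ≤ pp r := by
      have : 2 * qq r k ≤ pp r := by rw [← hsp]; nlinarith
      exact_mod_cast this
    have e4 : (w x ^ (k + 2)) ^ (2 * qq r k - 1) * w x ^ (k + 3) = w x ^ (pp r + 1) := by
      rw [← pow_mul, ← pow_add]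
      congr 1
      obtain ⟨c, hc⟩ : ∃ c, 2 * qq r k = c + 1 := ⟨2 * qq r k - 1, by omega⟩
      rw [← hsp, hc, Nat.add_sub_cancel]; ring
    calc _ ≤ (pp r : ℝ) * (w x ^ (k + 2)) ^ (2 * qq r k - 1) * (w x ^ (k + 3) / K) := by gcongr
      _ = _ := by rw [← e4]; ring
  have h4 : |pdR j (Wt g r S K) x| ≤ S.card * (pp r * w x ^ (pp r + 1) / K) := by
    rw [h2]
    refine (Finset.abs_sum_le_sum_abs _ _).trans ?_
    refine (Finset.sum_le_sum h3).trans ?_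
    rw [Finset.sum_const, nsmul_eq_mul]
  rw [h1, abs_mul, abs_of_pos (by positivity : (0:ℝ) < pp r * w x ^ (pp r - 1))] at h4
  have h5 : w x ^ (pp r + 1) = w x ^ (pp r - 1) * w x ^ 2 := by
    rw [← pow_add]; congr 1; omega
  have h6 : (0:ℝ) < pp r * w x ^ (pp r - 1) := by positivity
  refine le_of_mul_le_mul_left (h4.trans (le_of_eq ?_)) h6
  rw [h5]; ring

lemma gauge_all {g : List (Fin d) → Rd d → ℝ} {r : ℕ}
    (gs : ∀ l, ContDiff ℝ (⊤ : ℕ∞) (g l))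
    (gd : ∀ j l x, pdR j (g l) x = g (j :: l) x)
    (hz : ∀ l, r < l.length → ∀ x, g l x = 0)
    {l0 : List (Fin d)} (hl0 : l0.length ≤ r) (hne : ∀ x, g l0 x ≠ 0) :
    ∃ C, 0 < C ∧ ∀ a b K, TestPair a b K →
      ∫ x, (lapR a x ^ 2 + lapR b x ^ 2 + g [] x ^ 2 * eD a b x) ≤ C * ∫ x, fD (g []) a b x := by
  classical
  set S : Finset (List (Fin d)) := (List.finite_length_le (Fin d) r).toFinset with hSd
  have hS : ∀ l, l ∈ S ↔ l.length ≤ r := by intro l; simp [hSd]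
  obtain ⟨m, hm⟩ := exists_w (K := 1) one_pos gs gd hz hS hl0 hne
  have mp := hm.p
  have mn : ∀ x, m x * (m x)⁻¹ = 1 := fun x => mul_inv_cancel₀ (mp x).ne'
  have ns : ContDiff ℝ (⊤ : ℕ∞) (fun x => (m x)⁻¹) := hm.s.inv (fun x => (mp x).ne')
  have mb : ∀ l x, |g l x| ≤ m x ^ (l.length + 2) := by
    intro l x; simpa using hm.b l x
  have md : ∀ j x, |pdR j m x| ≤ S.card * m x ^ 2 := by
    intro j x; simpa using hm.dd j x
  have me : ∀ x, m x ^ pp r = ∑ l ∈ S, g l x ^ (2 * qq r l.length) := by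
    intro x; simpa [Wt] using hm.e x
  have G : Gauge g m (fun x => (m x)⁻¹) S.card := by
    refine ⟨gs, gd, hm.s, ns, mp, fun x => inv_pos.2 (mp x), mn, mb, ?_, by positivity⟩
    intro j x
    have h1 : pdR j (fun y => m y * (m y)⁻¹) x = 0 := by
      simp only [mn]; exact pdR_const 1 j x
    rw [pdR_mul hm.s.dif' ns.dif'] at h1
    have h2 : |m x * pdR j (fun y => (m y)⁻¹) x| = |pdR j m x| * (m x)⁻¹ := by
      have : m x * pdR j (fun y => (m y)⁻¹) x = -(pdR j m x * (m x)⁻¹) := by linarith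
      rw [this, abs_neg, abs_mul, abs_of_pos (inv_pos.2 (mp x))]
    rw [abs_mul, abs_of_pos (mp x)] at h2
    have h3 : |pdR j m x| * (m x)⁻¹ ≤ S.card * m x := by
      rw [← div_eq_mul_inv, div_le_iff₀ (mp x)]
      have := md j x
      nlinarith
    have := mp x
    exact le_of_mul_le_mul_left (by linarith) this
  refine max_est G S ?_ ?_
  · intro x
    have hp := pp_pos r
    have hp2 : 2 ≤ pp r := by
      have := Nat.factorial_pos (r + 2); unfold pp; omega
    have hnx : 0 < (m x)⁻¹ := inv_pos.2 (mp x)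
    have h0 : m x ^ 2 = m x ^ pp r * (m x)⁻¹ ^ (pp r - 2) := by
      have := mn_red (mn x) 2 (pp r - 2)
      rw [← this]; congr 2; omega
    rw [h0, me, Finset.sum_mul]
    refine Finset.sum_le_sum fun l hl => ?_
    have hlr := (hS l).1 hl
    have hq := qq_pos hlr
    have hsp := qq_spec hlr
    set k := l.length
    obtain ⟨c, hc⟩ : ∃ c, qq r k = c + 1 := ⟨qq r k - 1, by omega⟩
    have e1 : pp r - 2 = (2 * k + 2) + (k + 2) * (2 * c) := by
      rw [← hsp, hc]
      have : (k + 2) * (2 * (c + 1)) = (2 * k + 2) + (k + 2) * (2 * c) + 2 := by ring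
      omega
    have e2 : g l x ^ (2 * qq r k) ≤ g l x ^ 2 * m x ^ ((k + 2) * (2 * c)) := by
      rw [hc, show 2 * (c + 1) = 2 + 2 * c by ring, pow_add, pow_mul (m x)]
      refine mul_le_mul_of_nonneg_left ?_ (sq_nonneg _)
      have := pow_le_pow_left₀ (abs_nonneg _) (mb l x) (2 * c)
      rwa [pow_mul, sq_abs, ← pow_mul] at this
    calc g l x ^ (2 * qq r k) * (m x)⁻¹ ^ (pp r - 2)
        ≤ g l x ^ 2 * m x ^ ((k + 2) * (2 * c)) * (m x)⁻¹ ^ (pp r - 2) := by gcongr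
      _ = g l x ^ 2 * (m x ^ ((k + 2) * (2 * c)) * (m x)⁻¹ ^ ((2 * k + 2) + (k + 2) * (2 * c))) := by
          rw [e1]; ring
      _ = _ := by rw [mn_red' (mn x)]
  · intro ε hε
    set N : ℝ := (S.card : ℝ) with hN
    have hN0 : 0 ≤ N := by positivity
    set t : ℝ := 1 + 2 * N / ε with ht
    have ht1 : 1 ≤ t := by
      have : 0 ≤ 2 * N / ε := by positivity
      linarith
    have ht0 : 0 < t := by linarith
    have htε : 2 * N ≤ ε * t := by
      rw [ht, mul_add, mul_div_cancel₀ _ hε.ne']; linarith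
    obtain ⟨w, hw⟩ := exists_w (K := t ^ (r + 2)) (by positivity) gs gd hz hS hl0 hne
    have hp := pp_pos r
    have hev : ∀ l x, g l x ^ (2 * qq r l.length) = |g l x| ^ (2 * qq r l.length) := by
      intro l x; rw [pow_mul, ← sq_abs, ← pow_mul]
    have hK1 : ∀ k : ℕ, 1 ≤ (t ^ (r + 2)) ^ k := fun k => one_le_pow₀ (one_le_pow₀ ht1)
    have hmw : ∀ x, m x ≤ w x := by
      intro x
      refine le_of_pow_le_pow_left₀ hp.ne' (hw.p x).le ?_
      rw [me, hw.e]
      unfold Wt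
      refine Finset.sum_le_sum fun l _ => ?_
      rw [mul_pow, ← pow_mul, hev]
      exact le_mul_of_one_le_left (by positivity) (by rw [pow_mul]; exact one_le_pow₀ (hK1 _))
    have hwm : ∀ x, w x ≤ t ^ r * m x := by
      intro x
      have := mp x
      refine le_of_pow_le_pow_left₀ hp.ne' (by positivity) ?_
      rw [mul_pow, me, hw.e, Finset.mul_sum]
      unfold Wt
      refine Finset.sum_le_sum fun l hl => ?_
      have hlr := (hS l).1 hl
      rw [mul_pow, hev]
      refine mul_le_mul_of_nonneg_right ?_ (by positivity)
      rw [← pow_mul, ← pow_mul, ← pow_mul]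
      refine pow_le_pow_right₀ ht1 ?_
      rw [← qq_spec hlr, ← mul_assoc r, ← mul_assoc (r + 2)]
      refine Nat.mul_le_mul_right _ ?_
      nlinarith
    refine ⟨fun x => w x ^ 2, (t ^ r) ^ 2, by positivity, ⟨hw.s.pow 2, fun x => sq_nonneg _, ?_⟩, ?_, ?_⟩
    · intro j x
      have wp := hw.p x
      have mpx := mp x
      rw [pdR_pow hw.s.dif', abs_mul]
      have h1 : |((2:ℕ):ℝ) * w x ^ (2 - 1)| = 2 * w x := by
        simp [abs_of_pos wp]
      rw [h1]
      have h2 := hw.dd j x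
      rw [← hN] at h2
      have h3 : N / t ^ (r + 2) * w x ≤ ε / 2 * m x := by
        have e := hwm x
        rw [div_mul_eq_mul_div, div_le_iff₀ (by positivity)]
        have : N ≤ ε / 2 * t ^ 2 := by nlinarith
        calc N * w x ≤ (ε / 2 * t ^ 2) * (t ^ r * m x) := by gcongr
          _ = _ := by ring
      calc 2 * w x * |pdR j w x| ≤ 2 * w x * (N / t ^ (r + 2) * w x ^ 2) := by gcongr
        _ = 2 * w x ^ 2 * (N / t ^ (r + 2) * w x) := by ring
        _ ≤ 2 * w x ^ 2 * (ε / 2 * m x) := by gcongr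
        _ = _ := by ring
    · intro x
      have := mp x
      have := hmw x
      show m x ^ 2 ≤ w x ^ 2
      gcongr
    · intro x
      have := hw.p x
      have := hwm x
      show w x ^ 2 ≤ _
      rw [← mul_pow]
      gcongr

end GaugeC

section Final

variable {d : ℕ}

lemma real_est (V : MvPolynomial (Fin d) ℝ) :
    ∃ C, 0 < C ∧ ∀ a b K, TestPair a b K →
      ∫ x, (lapR a x ^ 2 + lapR b x ^ 2 + gf V [] x ^ 2 * eD a b x)
        ≤ C * ∫ x, fD (gf V []) a b x := by
  by_cases hV : V = 0
  · refine ⟨1, one_pos, fun a b K _ => ?_⟩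
    have h0 : ∀ x : Rd d, gf V [] x = 0 := fun x => by simp [gf, gp, hV]
    simp [fD, h0]
  · obtain ⟨r, h1, l0, h2, h3⟩ := exists_top V hV
    refine gauge_all (g := gf V) (r := r) (fun l => eval_smooth _) (fun j l x => ?_) ?_ h2.le h3
    · exact pdR_eval (gp V l) j x
    · intro l hl x
      simp [gf, h1 l hl]

lemma pdC_re {u : Rd d → ℂ} (hu : ContDiff ℝ (⊤ : ℕ∞) u) (j : Fin d) (x : Rd d) :
    (pdC j u x).re = pdR j (fun y => (u y).re) x := by
  have hd : DifferentiableAt ℝ u x := (hu.differentiable (by simp)) x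
  have := (Complex.reCLM.hasFDerivAt.comp x hd.hasFDerivAt).fderiv
  have h2 : (fun y => (u y).re) = Complex.reCLM ∘ u := rfl
  unfold pdR pdC
  rw [h2, this]; rfl

lemma pdC_im {u : Rd d → ℂ} (hu : ContDiff ℝ (⊤ : ℕ∞) u) (j : Fin d) (x : Rd d) :
    (pdC j u x).im = pdR j (fun y => (u y).im) x := by
  have hd : DifferentiableAt ℝ u x := (hu.differentiable (by simp)) x
  have := (Complex.imCLM.hasFDerivAt.comp x hd.hasFDerivAt).fderiv
  have h2 : (fun y => (u y).im) = Complex.imCLM ∘ u := rfl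
  unfold pdR pdC
  rw [h2, this]; rfl

lemma pdC_smooth {u : Rd d → ℂ} (hu : ContDiff ℝ (⊤ : ℕ∞) u) (j : Fin d) :
    ContDiff ℝ (⊤ : ℕ∞) (pdC j u) := by
  unfold pdC
  exact (hu.fderiv_right (by simp)).clm_apply contDiff_const

lemma normsq_c (z : ℂ) : ‖z‖ ^ 2 = z.re ^ 2 + z.im ^ 2 := by
  rw [Complex.sq_norm, Complex.normSq_apply]; ring

end Final

/-- maximal estimate for `-Δ + iV` with `V` a real polynomial. -/
theorem statement_8 (d : ℕ) (V : MvPolynomial (Fin d) ℝ) :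
    ∃ C > 0, ∀ u : Rd d → ℂ, ContDiff ℝ (⊤ : ℕ∞) u → HasCompactSupport u →
      (∑ j, ∑ ℓ, Real.sqrt (∫ x : Rd d, ‖pdC j (pdC ℓ u) x‖^2))
        + Real.sqrt (∫ x : Rd d, (MvPolynomial.eval (fun i => x i) V)^2 * ‖u x‖^2)
      ≤ C * Real.sqrt (∫ x : Rd d,
          ‖-(∑ j, pdC j (pdC j u) x)
            + ((MvPolynomial.eval (fun i => x i) V : ℝ) : ℂ) * Complex.I * u x‖^2) := by
  obtain ⟨C, hC, hmain⟩ := real_est V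
  refine ⟨((d : ℝ) * d + 1) * Real.sqrt C, by positivity, fun u hu hcs => ?_⟩
  set a : Rd d → ℝ := fun x => (u x).re with ha
  set b : Rd d → ℝ := fun x => (u x).im with hb
  have hT : TestPair a b (tsupport u) := by
    refine ⟨hcs, Complex.reCLM.contDiff.comp hu, Complex.imCLM.contDiff.comp hu, ?_, ?_⟩
    · intro x hx; simp [ha, image_eq_zero_of_notMem_tsupport hx]
    · intro x hx; simp [hb, image_eq_zero_of_notMem_tsupport hx]
  have r2 : ∀ j l x, (pdC j (pdC l u) x).re = pdR j (pdR l a) x := by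
    intro j l x
    rw [pdC_re (pdC_smooth hu l)]
    congr 1; funext y; exact pdC_re hu l y
  have i2 : ∀ j l x, (pdC j (pdC l u) x).im = pdR j (pdR l b) x := by
    intro j l x
    rw [pdC_im (pdC_smooth hu l)]
    congr 1; funext y; exact pdC_im hu l y
  have hN : ∀ x : Rd d, ‖-(∑ j, pdC j (pdC j u) x)
            + ((MvPolynomial.eval (fun i => x i) V : ℝ) : ℂ) * Complex.I * u x‖^2
      = fD (gf V []) a b x := by
    intro x
    rw [normsq_c]
    have e1 : (-(∑ j, pdC j (pdC j u) x)
            + ((MvPolynomial.eval (fun i => x i) V : ℝ) : ℂ) * Complex.I * u x).re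
        = -lapR a x - gf V [] x * b x := by
      simp only [Complex.add_re, Complex.neg_re, Complex.re_sum, r2, Complex.mul_re, Complex.mul_im,
        Complex.ofReal_re, Complex.ofReal_im, Complex.I_re, Complex.I_im, lapR, gf, gp, hb]
      ring
    have e2 : (-(∑ j, pdC j (pdC j u) x)
            + ((MvPolynomial.eval (fun i => x i) V : ℝ) : ℂ) * Complex.I * u x).im
        = -lapR b x + gf V [] x * a x := by
      simp only [Complex.add_im, Complex.neg_im, Complex.im_sum, i2, Complex.mul_re, Complex.mul_im,
        Complex.ofReal_re, Complex.ofReal_im, Complex.I_re, Complex.I_im, lapR, gf, gp, ha]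
      ring
    rw [e1, e2]; rfl
  have hH : ∀ j l, ∀ x, ‖pdC j (pdC l u) x‖^2 = pdR j (pdR l a) x ^ 2 + pdR j (pdR l b) x ^ 2 := by
    intro j l x; rw [normsq_c, r2, i2]
  have hE : ∀ x : Rd d, (MvPolynomial.eval (fun i => x i) V)^2 * ‖u x‖^2
      = gf V [] x ^ 2 * eD a b x := by
    intro x; rw [normsq_c]; rfl
  simp only [hN, hH, hE]
  have hV0 : Continuous (gf V []) := (eval_smooth (gp V [])).continuous
  have ca := hT.cla
  have cb := hT.clb
  have ce := hT.ce
  have j1 : Integrable (fun x => lapR a x ^ 2 + lapR b x ^ 2) :=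
    integrable_cs hT.cK (by fun_prop) (fun x hx => by simp [hT.vla x hx, hT.vlb x hx])
  have j2 : Integrable (fun x => gf V [] x ^ 2 * eD a b x) :=
    integrable_cs hT.cK (by fun_prop) (fun x hx => by simp [hT.ve x hx])
  have hm := hmain a b _ hT
  rw [integral_add j1 j2] at hm
  have p1 : 0 ≤ ∫ x, (lapR a x ^ 2 + lapR b x ^ 2) := integral_nonneg fun x => by positivity
  have p2 : 0 ≤ ∫ x, gf V [] x ^ 2 * eD a b x := integral_nonneg fun x => by
    have := eD_nonneg a b x
    positivity
  set F := ∫ x, fD (gf V []) a b x with hF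
  have q1 : ∀ j l, Real.sqrt (∫ x, (pdR j (pdR l a) x ^ 2 + pdR j (pdR l b) x ^ 2))
      ≤ Real.sqrt C * Real.sqrt F := by
    intro j l
    rw [← Real.sqrt_mul hC.le]
    apply Real.sqrt_le_sqrt
    have := hess_le hT j l
    linarith
  have q2 : Real.sqrt (∫ x, gf V [] x ^ 2 * eD a b x) ≤ Real.sqrt C * Real.sqrt F := by
    rw [← Real.sqrt_mul hC.le]
    apply Real.sqrt_le_sqrt
    linarith
  have q3 := Finset.sum_le_sum (s := Finset.univ) fun (j : Fin d) _ =>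
    Finset.sum_le_sum (s := Finset.univ) fun (l : Fin d) _ => q1 j l
  simp only [Finset.sum_const, Finset.card_univ, Fintype.card_fin, nsmul_eq_mul] at q3
  calc _ ≤ _ := add_le_add q3 q2
    _ = _ := by ring

end
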